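/- arXiv:1809.06819 — 3 statements merged into one kernel-verified Lean document; each statement's English description precedes it below -/
import Mathlib

section
/- Let X be a λ-set such that: (1) X is strongly homogeneous, i.e. all nonempty clopen subsets of X are homeomorphic to one another; and (2) whenever A ⊆ X is countable and B ⊆ X is nowhere dense, there is a nowhere dense set B' ⊆ X homeomorphic to B with A ∩ B' = ∅. Then X is countable dense homogeneous. -/
open Set TopologicalSpace

/-- A space is zero-dimensional if it has a basis of clopen sets. -/
def ZeroDimensional (X : Type*) [TopologicalSpace X] : Prop :=
  ∃ B : Set (Set X), IsTopologicalBasis B ∧ ∀ s ∈ B, IsClopen s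

/-- A λ-set (as a space): a zero-dimensional separable metrizable space in which
every countable subset is a (relative) Gδ-set. -/
def IsLambdaSpace (X : Type*) [TopologicalSpace X] : Prop :=
  ZeroDimensional X ∧ SeparableSpace X ∧ MetrizableSpace X ∧
    ∀ A : Set X, A.Countable → IsGδ A

/-- A space is countable dense homogeneous (CDH) if for any two countable dense subsets
`D`, `E` there is a homeomorphism of the space mapping `D` onto `E`. -/
def IsCDH (X : Type*) [TopologicalSpace X] : Prop :=
  ∀ D E : Set X, D.Countable → Dense D → E.Countable → Dense E →
    ∃ f : X ≃ₜ X, f '' D = E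

/-- A clopen neighbourhood of a non-isolated point contains a strictly decreasing sequence of
clopen sets shrinking to the point. -/
theorem exists_clopen_sequence {X : Type*} [MetricSpace X] (hz : ZeroDimensional X) (a : X)
    (ha : ¬ IsOpen ({a} : Set X)) (W : Set X) (hW : IsClopen W) (haW : a ∈ W) :
    ∃ O : ℕ → Set X, O 0 = W ∧ (∀ n, IsClopen (O n)) ∧ (∀ n, a ∈ O n) ∧ Antitone O ∧
      (∀ n, (O n \ O (n + 1)).Nonempty) ∧ ∀ N ∈ nhds a, ∃ n, O n ⊆ N := by
  obtain ⟨B, hB, hBc⟩ := hz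
  have step : ∀ (n : ℕ) (V : {V : Set X // IsClopen V ∧ a ∈ V}),
      ∃ V' : {V : Set X // IsClopen V ∧ a ∈ V}, V'.1 ⊆ V.1 ∧ (V.1 \ V'.1).Nonempty ∧
        V'.1 ⊆ Metric.ball a (1 / (n + 1)) := by
    rintro n ⟨V, hV, haV⟩
    obtain ⟨c, hcV, hca⟩ : ∃ c ∈ V, c ≠ a := by
      by_contra! h
      apply ha
      have : V = {a} := Set.eq_singleton_iff_unique_mem.2 ⟨haV, h⟩
      exact this ▸ hV.isOpen
    have hopen : IsOpen (V ∩ Metric.ball a (1 / (n + 1)) ∩ {c}ᶜ) :=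
      (hV.isOpen.inter Metric.isOpen_ball).inter isOpen_compl_singleton
    obtain ⟨V', hV'B, haV', hsub⟩ := hB.exists_subset_of_mem_open
      (show a ∈ V ∩ Metric.ball a (1 / (n + 1)) ∩ {c}ᶜ from
        ⟨⟨haV, Metric.mem_ball_self (by positivity)⟩, fun h => hca h.symm⟩) hopen
    exact ⟨⟨V', hBc _ hV'B, haV'⟩, fun x hx => (hsub hx).1.1,
      ⟨c, hcV, fun h => (hsub h).2 rfl⟩, fun x hx => (hsub hx).1.2⟩
  choose s hs using step
  let O : ℕ → {V : Set X // IsClopen V ∧ a ∈ V} := fun n => Nat.rec ⟨W, hW, haW⟩ s n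
  refine ⟨fun n => (O n).1, rfl, fun n => (O n).2.1, fun n => (O n).2.2,
    antitone_nat_of_succ_le fun n => (hs n (O n)).1, fun n => (hs n (O n)).2.1, fun N hN => ?_⟩
  obtain ⟨r, hr, hrN⟩ := Metric.mem_nhds_iff.1 hN
  obtain ⟨n, hn⟩ := exists_nat_one_div_lt hr
  exact ⟨n + 1, ((hs n (O n)).2.2.trans (Metric.ball_subset_ball hn.le)).trans hrN⟩

/-- Continuous maps between the successive differences of two decreasing sequences of clopen sets
shrinking to `a` and `b` glue to a continuous map sending `a` to `b`. -/
theorem exists_continuous_glue {X : Type*} [TopologicalSpace X] {a b : X} {O O' : ℕ → Set X}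
    (h0 : O 0 = univ) (hO : ∀ n, IsClopen (O n)) (haO : ∀ n, a ∈ O n) (hanti : Antitone O)
    (hsep : ∀ x, x ≠ a → ∃ n, x ∉ O n)
    (hbO : ∀ n, b ∈ O' n) (hanti' : Antitone O')
    (hbase' : ∀ N ∈ nhds b, ∃ n, O' n ⊆ N)
    (e : ∀ n, ↥(O n \ O (n + 1)) → ↥(O' n \ O' (n + 1))) (he : ∀ n, Continuous (e n)) :
    ∃ F : X → X, Continuous F ∧ F a = b ∧
      ∀ n (x : ↥(O n \ O (n + 1))), F x = e n x := by
  have huniq : ∀ {x m n}, x ∈ O m \ O (m + 1) → x ∈ O n → n ≤ m := by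
    intro x m n hx hn
    by_contra! h
    exact hx.2 (hanti (Nat.succ_le_of_lt h) hn)
  have htot : ∀ x, ∃ y, (x = a ∧ y = b) ∨
      ∃ n, ∃ h : x ∈ O n \ O (n + 1), y = (e n ⟨x, h⟩ : X) := by
    intro x
    by_cases hx : x = a
    · exact ⟨b, Or.inl ⟨hx, rfl⟩⟩
    · classical
      have hex := hsep x hx
      have hpos : Nat.find hex ≠ 0 := fun h => by
        have := Nat.find_spec hex
        rw [h, h0] at this
        exact this (mem_univ x)
      obtain ⟨m, hm⟩ := Nat.exists_eq_succ_of_ne_zero hpos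
      have h1 : x ∈ O m := by
        by_contra h
        have := Nat.find_min' hex h
        omega
      have h2 : x ∉ O (m + 1) := by
        have := Nat.find_spec hex
        rwa [hm] at this
      exact ⟨_, Or.inr ⟨m, ⟨h1, h2⟩, rfl⟩⟩
  choose F hF using htot
  have hFa : F a = b := by
    rcases hF a with h | ⟨n, h, -⟩
    · exact h.2
    · exact absurd (haO _) h.2
  have hFe : ∀ n (x : ↥(O n \ O (n + 1))), F x = e n x := by
    rintro n ⟨x, hx⟩
    rcases hF x with h | ⟨m, h, h'⟩
    · exact absurd (h.1 ▸ haO _) hx.2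
    · obtain rfl : m = n := le_antisymm (huniq hx h.1) (huniq h hx.1)
      exact h'
  refine ⟨F, continuous_iff_continuousAt.2 fun x => ?_, hFa, hFe⟩
  rcases hF x with ⟨rfl, -⟩ | ⟨n, h, -⟩
  · rw [ContinuousAt, hFa]
    intro N hN
    obtain ⟨n, hn⟩ := hbase' N hN
    refine Filter.mem_map.2 (Filter.mem_of_superset ((hO n).isOpen.mem_nhds (haO n)) fun z hz => ?_)
    rcases hF z with ⟨-, h⟩ | ⟨m, h, h'⟩
    · exact hn (h ▸ hbO n)
    · rw [mem_preimage, h']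
      exact hn (hanti' (huniq h hz) (e m ⟨z, h⟩).2.1)
  · have hopen : IsOpen (O n \ O (n + 1)) := (hO n).isOpen.sdiff (hO (n + 1)).isClosed
    have hon : ContinuousOn F (O n \ O (n + 1)) := by
      rw [continuousOn_iff_continuous_domRestrict]
      have : (O n \ O (n + 1)).domRestrict F = fun x => (e n x : X) := funext fun x => hFe n x
      rw [this]
      exact continuous_subtype_val.comp (he n)
    exact hon.continuousAt (hopen.mem_nhds h)

/-- In a strongly homogeneous zero-dimensional metric space without isolated points, any two points
of a clopen set `W` are exchanged by a homeomorphism supported in `W`. -/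
theorem exists_homeomorph_supported {X : Type*} [MetricSpace X] (hz : ZeroDimensional X)
    (hiso : ∀ x : X, ¬ IsOpen ({x} : Set X))
    (hsh : ∀ U V : Set X, IsClopen U → U.Nonempty → IsClopen V → V.Nonempty →
      Nonempty (↥U ≃ₜ ↥V))
    {W : Set X} (hW : IsClopen W) {a b : X} (ha : a ∈ W) (hb : b ∈ W) :
    ∃ φ : X ≃ₜ X, φ a = b ∧ ∀ x, x ∉ W → φ x = x := by
  obtain ⟨P, hP0, hPc, haP, hPa, hPne, hPb⟩ := exists_clopen_sequence hz a (hiso a) W hW ha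
  obtain ⟨Q, hQ0, hQc, hbQ, hQa, hQne, hQb⟩ := exists_clopen_sequence hz b (hiso b) W hW hb
  let shift : (ℕ → Set X) → ℕ → Set X := fun P n => Nat.casesOn n univ P
  have hclopen : ∀ P : ℕ → Set X, (∀ n, IsClopen (P n)) → ∀ n, IsClopen (shift P n) := by
    rintro P hP (_ | n)
    exacts [isClopen_univ, hP n]
  have hmem : ∀ (P : ℕ → Set X) c, (∀ n, c ∈ P n) → ∀ n, c ∈ shift P n := by
    rintro P c hP (_ | n)
    exacts [mem_univ c, hP n]
  have hanti : ∀ P : ℕ → Set X, Antitone P → Antitone (shift P) := by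
    intro P hP
    refine antitone_nat_of_succ_le ?_
    rintro (_ | n)
    exacts [subset_univ _, hP n.le_succ]
  have hbase : ∀ (P : ℕ → Set X) c, (∀ N ∈ nhds c, ∃ n, P n ⊆ N) →
      ∀ N ∈ nhds c, ∃ n, shift P n ⊆ N := by
    intro P c hP N hN
    obtain ⟨n, hn⟩ := hP N hN
    exact ⟨n + 1, hn⟩
  have hsep : ∀ (P : ℕ → Set X) c, (∀ N ∈ nhds c, ∃ n, P n ⊆ N) →
      ∀ x, x ≠ c → ∃ n, x ∉ shift P n := by
    intro P c hP x hx
    obtain ⟨n, hn⟩ := hP {x}ᶜ (isOpen_compl_singleton.mem_nhds (Ne.symm hx))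
    exact ⟨n + 1, fun h => hn h rfl⟩
  have hPQ : P 0 = Q 0 := hP0.trans hQ0.symm
  obtain ⟨e, he0⟩ : ∃ e : ∀ n, ↥(shift P n \ shift P (n + 1)) ≃ₜ ↥(shift Q n \ shift Q (n + 1)),
      ∀ x, (e 0 x : X) = x := by
    have hsucc : ∀ n, Nonempty (↥(P n \ P (n + 1)) ≃ₜ ↥(Q n \ Q (n + 1))) := fun n =>
      hsh _ _ ((hPc n).diff (hPc _)) (hPne n) ((hQc n).diff (hQc _)) (hQne n)
    have hzero : univ \ P 0 = univ \ Q 0 := congrArg (univ \ ·) hPQ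
    exact ⟨fun n => match n with
      | 0 => Homeomorph.setCongr hzero
      | n + 1 => (hsucc n).some, fun x => rfl⟩
  obtain ⟨F, hFc, hFa, hF⟩ := exists_continuous_glue rfl (hclopen P hPc) (hmem P a haP)
    (hanti P hPa) (hsep P a hPb) (hmem Q b hbQ) (hanti Q hQa) (hbase Q b hQb)
    (fun n => e n) fun n => (e n).continuous
  obtain ⟨G, hGc, hGb, hG⟩ := exists_continuous_glue rfl (hclopen Q hQc) (hmem Q b hbQ)
    (hanti Q hQa) (hsep Q b hQb) (hmem P a haP) (hanti P hPa) (hbase P a hPb)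
    (fun n => (e n).symm) fun n => (e n).symm.continuous
  have hcover : ∀ (P : ℕ → Set X) c, (∀ N ∈ nhds c, ∃ n, P n ⊆ N) → ∀ x, x = c ∨
      ∃ n, x ∈ shift P n \ shift P (n + 1) := by
    intro P c hP x
    by_contra! h
    obtain ⟨n, hn⟩ := hsep P c hP x h.1
    have : ∀ n, x ∈ shift P n := by
      intro n
      induction n with
      | zero => exact mem_univ x
      | succ n ih =>
        by_contra hx
        exact h.2 n ⟨ih, hx⟩
    exact hn (this n)
  have hGF : ∀ x, G (F x) = x := by
    intro x
    rcases hcover P a hPb x with rfl | ⟨n, hn⟩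
    · rw [hFa, hGb]
    · rw [hF n ⟨x, hn⟩, hG n, Homeomorph.symm_apply_apply]
  have hFG : ∀ x, F (G x) = x := by
    intro x
    rcases hcover Q b hQb x with rfl | ⟨n, hn⟩
    · rw [hGb, hFa]
    · rw [hG n ⟨x, hn⟩, hF n, Homeomorph.apply_symm_apply]
  refine ⟨⟨⟨F, G, hGF, hFG⟩, hFc, hGc⟩, hFa, fun x hx => ?_⟩
  have hx0 : x ∈ shift P 0 \ shift P (0 + 1) := ⟨mem_univ x, fun h => hx (hP0 ▸ h)⟩
  exact (hF 0 ⟨x, hx0⟩).trans (he0 _)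

/-- In a strongly homogeneous zero-dimensional metric space without isolated points, a point can be
moved to any other by a homeomorphism supported in a ball of comparable radius. -/
theorem exists_homeomorph_near {X : Type*} [MetricSpace X] (hz : ZeroDimensional X)
    (hiso : ∀ x : X, ¬ IsOpen ({x} : Set X))
    (hsh : ∀ U V : Set X, IsClopen U → U.Nonempty → IsClopen V → V.Nonempty →
      Nonempty (↥U ≃ₜ ↥V)) (a b : X) :
    ∃ φ : X ≃ₜ X, φ a = b ∧
      ∀ x, φ x = x ∨ (dist x a < 2 * dist a b ∧ dist (φ x) a < 2 * dist a b) := by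
  by_cases hab : a = b
  · exact ⟨Homeomorph.refl X, hab, fun x => Or.inl rfl⟩
  have hpos : 0 < dist a b := dist_pos.2 hab
  obtain ⟨B, hB, hBc⟩ := id hz
  have hclopen : ∀ c ∈ Metric.ball a (2 * dist a b),
      ∃ V, IsClopen V ∧ c ∈ V ∧ V ⊆ Metric.ball a (2 * dist a b) := fun c hc => by
    obtain ⟨V, hV, hcV, hVs⟩ := hB.exists_subset_of_mem_open hc Metric.isOpen_ball
    exact ⟨V, hBc V hV, hcV, hVs⟩
  obtain ⟨V₁, hV₁, haV₁, hV₁s⟩ := hclopen a (Metric.mem_ball_self (by linarith))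
  obtain ⟨V₂, hV₂, hbV₂, hV₂s⟩ := hclopen b (by rw [Metric.mem_ball, dist_comm]; linarith)
  obtain ⟨φ, hφ, hφW⟩ := exists_homeomorph_supported hz hiso hsh (hV₁.union hV₂)
    (Or.inl haV₁ : a ∈ V₁ ∪ V₂) (Or.inr hbV₂)
  refine ⟨φ, hφ, fun x => ?_⟩
  by_cases hx : φ x = x
  · exact Or.inl hx
  · refine Or.inr ⟨union_subset hV₁s hV₂s ?_, union_subset hV₁s hV₂s ?_⟩
    · by_contra h
      exact hx (hφW x h)
    · by_contra h
      exact hx (φ.injective (hφW _ h))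

/-- Every countable set is contained in a countable set closed under a family of self-bijections
indexed by pairs of its points, and under their inverses. -/
theorem exists_countable_invariant {X : Type*} [TopologicalSpace X] (φ : X → X → X ≃ₜ X)
    {S : Set X} (hS : S.Countable) :
    ∃ A : Set X, S ⊆ A ∧ A.Countable ∧
      ∀ a ∈ A, ∀ b ∈ A, ∀ x, φ a b x ∈ A ↔ x ∈ A := by
  let next : Set X → Set X := fun T => T ∪ ⋃ a ∈ T, ⋃ b ∈ T, (φ a b '' T ∪ (φ a b).symm '' T)
  let T : ℕ → Set X := fun n => Nat.rec S (fun _ => next) n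
  have hmono : Monotone T := monotone_nat_of_le_succ fun n => subset_union_left
  have hcount : ∀ n, (T n).Countable := by
    intro n
    induction n with
    | zero => exact hS
    | succ n ih =>
      exact ih.union (ih.biUnion fun a _ => ih.biUnion fun b _ => (ih.image _).union (ih.image _))
  have hclosed : ∀ a ∈ ⋃ n, T n, ∀ b ∈ ⋃ n, T n, ∀ x ∈ ⋃ n, T n,
      φ a b x ∈ ⋃ n, T n ∧ (φ a b).symm x ∈ ⋃ n, T n := by
    intro a ha b hb x hx
    obtain ⟨i, hi⟩ := mem_iUnion.1 ha
    obtain ⟨j, hj⟩ := mem_iUnion.1 hb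
    obtain ⟨k, hk⟩ := mem_iUnion.1 hx
    obtain ⟨m, him, hjm, hkm⟩ : ∃ m, i ≤ m ∧ j ≤ m ∧ k ≤ m :=
      ⟨i + j + k, by omega, by omega, by omega⟩
    have key : φ a b '' T m ∪ (φ a b).symm '' T m ⊆ T (m + 1) := fun y hy =>
      Or.inr (mem_biUnion (hmono him hi) (mem_biUnion (hmono hjm hj) hy))
    exact ⟨mem_iUnion.2 ⟨m + 1, key (Or.inl ⟨x, hmono hkm hk, rfl⟩)⟩,
      mem_iUnion.2 ⟨m + 1, key (Or.inr ⟨x, hmono hkm hk, rfl⟩)⟩⟩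
  refine ⟨⋃ n, T n, subset_iUnion T 0, countable_iUnion hcount, fun a ha b hb x => ⟨fun h => ?_,
    fun h => (hclosed a ha b hb x h).1⟩⟩
  simpa using (hclosed a ha b hb _ h).2

/-- A sequence of homeomorphisms which is pointwise eventually constant and geometrically Cauchy,
together with the sequence of inverses, has a homeomorphism as its limit. -/
theorem exists_homeomorph_limit {X : Type*} [MetricSpace X] (h : ℕ → X ≃ₜ X)
    (hd : ∀ n x, dist (h n x) (h (n + 1) x) ≤ 1 * (1 / 2) ^ n)
    (hd' : ∀ n x, dist ((h n).symm x) ((h (n + 1)).symm x) ≤ 1 * (1 / 2) ^ n)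
    (hev : ∀ x, ∃ N, ∀ n ≥ N, h n x = h N x)
    (hev' : ∀ x, ∃ N, ∀ n ≥ N, (h n).symm x = (h N).symm x) :
    ∃ f : X ≃ₜ X, ∀ x, ∃ N, ∀ n ≥ N, h n x = f x := by
  have hcont : ∀ g : ℕ → X ≃ₜ X, (∀ n x, dist (g n x) (g (n + 1) x) ≤ 1 * (1 / 2) ^ n) →
      (∀ x, ∃ N, ∀ n ≥ N, g n x = g N x) →
      ∃ f : X → X, Continuous f ∧ ∀ x, ∃ N, ∀ n ≥ N, g n x = f x := by
    intro g hg hgev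
    choose N hN using hgev
    have hlim : ∀ x, Filter.Tendsto (fun n => g n x) Filter.atTop (nhds (g (N x) x)) := fun x =>
      tendsto_const_nhds.congr' <| by
        filter_upwards [Filter.eventually_ge_atTop (N x)] with n hn using (hN x n hn).symm
    refine ⟨fun x => g (N x) x, ?_, fun x => ⟨N x, hN x⟩⟩
    have hunif : TendstoUniformly (fun n x => g n x) (fun x => g (N x) x) Filter.atTop := by
      rw [Metric.tendstoUniformly_iff]
      intro ε hε
      have h2 : Filter.Tendsto (fun n : ℕ => 1 * (1 / 2 : ℝ) ^ n / (1 - 1 / 2)) Filter.atTop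
          (nhds 0) := by
        have := ((tendsto_pow_atTop_nhds_zero_of_lt_one (r := (1 / 2 : ℝ)) (by norm_num)
          (by norm_num)).const_mul 1).div_const (1 - 1 / 2)
        simpa using this
      filter_upwards [h2.eventually (gt_mem_nhds hε)] with n hn x
      rw [dist_comm]
      exact (dist_le_of_le_geometric_of_tendsto _ _ (by norm_num) (fun k => hg k x) (hlim x)
        n).trans_lt hn
    exact hunif.continuous (Filter.Frequently.of_forall fun n => (g n).continuous)
  obtain ⟨f, hf, hfe⟩ := hcont h hd hev
  obtain ⟨k, hk, hke⟩ := hcont (fun n => (h n).symm) hd' hev'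
  refine ⟨⟨⟨f, k, fun x => ?_, fun x => ?_⟩, hf, hk⟩, hfe⟩
  · obtain ⟨N, hN⟩ := hfe x
    obtain ⟨M, hM⟩ := hke (f x)
    rw [← hM (max M N) (le_max_left _ _), ← hN (max M N) (le_max_right _ _)]
    exact (h _).symm_apply_apply x
  · obtain ⟨N, hN⟩ := hfe (k x)
    obtain ⟨M, hM⟩ := hke x
    rw [← hN (max M N) (le_max_right _ _), ← hM (max M N) (le_max_left _ _)]
    exact (h _).apply_symm_apply x

/-- A homeomorphism preserving `A` can be modified slightly near a point `a ∈ A` so that `a` is sent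
into `E` exactly when it lies in `D`, without changing it on a closed set avoiding `A` or its
preimage, nor at finitely many points where the correspondence already holds. -/
theorem exists_homeomorph_adjust_point {X : Type*} [MetricSpace X] {A D E F P : Set X}
    (hEA : E ⊆ A) (hE : Dense E) (hE' : Dense (A \ E))
    (φ : X → X → X ≃ₜ X) (hφ : ∀ a b, φ a b a = b)
    (hφd : ∀ a b x, φ a b x = x ∨ (dist x a < 2 * dist a b ∧ dist (φ a b x) a < 2 * dist a b))
    (hA : ∀ a ∈ A, ∀ b ∈ A, ∀ x, φ a b x ∈ A ↔ x ∈ A)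
    (hF : IsClosed F) (hFA : Disjoint F A) (hP : P.Finite)
    (h : X ≃ₜ X) (hh : ∀ x, h x ∈ A ↔ x ∈ A) (hPh : ∀ p ∈ P, p ∈ D ↔ h p ∈ E)
    {a : X} (ha : a ∈ A) {ε : ℝ} (hε : 0 < ε) :
    ∃ h' : X ≃ₜ X, (∀ x, h' x ∈ A ↔ x ∈ A) ∧ (∀ x, dist (h x) (h' x) ≤ ε) ∧
      (∀ x, dist (h.symm x) (h'.symm x) ≤ ε) ∧
      (∀ x, x ∈ F ∨ h x ∈ F ∨ x ∈ P → h' x = h x) ∧ (a ∈ D ↔ h' a ∈ E) := by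
  by_cases haP : a ∈ P
  · exact ⟨h, hh, fun x => by simpa using hε.le, fun x => by simpa using hε.le,
      fun x _ => rfl, hPh a haP⟩
  have hmem : Metric.ball a (ε / 2) ∩ h ⁻¹' Metric.ball (h a) (ε / 2) ∩
      (F ∪ h ⁻¹' F ∪ P)ᶜ ∈ nhds a := by
    refine IsOpen.mem_nhds ((Metric.isOpen_ball.inter
      (Metric.isOpen_ball.preimage h.continuous)).inter
      ((hF.union (hF.preimage h.continuous)).union hP.isClosed).isOpen_compl)
      ⟨⟨Metric.mem_ball_self (by linarith), Metric.mem_ball_self (by linarith)⟩, ?_⟩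
    rintro ((hx | hx) | hx)
    · exact hFA.notMem_of_mem_left hx ha
    · exact hFA.notMem_of_mem_left hx ((hh a).2 ha)
    · exact haP hx
  obtain ⟨η, hη, hball⟩ := Metric.mem_nhds_iff.1 hmem
  obtain ⟨b, hbA, hab, hb⟩ : ∃ b ∈ A, 2 * dist a b < η ∧ (a ∈ D ↔ h b ∈ E) := by
    have hdense : ∀ T : Set X, Dense T → ∃ b, 2 * dist a b < η ∧ h b ∈ T := by
      intro T hT
      obtain ⟨b, hb, hbT⟩ := (hT.preimage h.isOpenMap).exists_mem_open
        (Metric.isOpen_ball (x := a) (ε := η / 2)) ⟨a, Metric.mem_ball_self (by linarith)⟩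
      rw [Metric.mem_ball, dist_comm] at hbT
      exact ⟨b, by linarith, hb⟩
    by_cases haD : a ∈ D
    · obtain ⟨b, hb, hbE⟩ := hdense E hE
      exact ⟨b, (hh b).1 (hEA hbE), hb, iff_of_true haD hbE⟩
    · obtain ⟨b, hb, hbE⟩ := hdense _ hE'
      exact ⟨b, (hh b).1 hbE.1, hb, iff_of_false haD hbE.2⟩
  have hmove : ∀ x, φ a b x = x ∨
      (x ∈ Metric.ball a η ∧ φ a b x ∈ Metric.ball a η) := fun x =>
    (hφd a b x).imp_right fun hx => ⟨hx.1.trans hab, hx.2.trans hab⟩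
  refine ⟨(φ a b).trans h, fun x => (hh _).trans (hA a ha b hbA x), fun x => ?_, fun x => ?_,
    fun x hx => ?_, ?_⟩
  · change dist (h x) (h (φ a b x)) ≤ ε
    rcases hmove x with hx | ⟨hx, hx'⟩
    · rw [hx, dist_self]; exact hε.le
    · have h1 : dist (h x) (h a) < ε / 2 := (hball hx).1.2
      have h2 : dist (h (φ a b x)) (h a) < ε / 2 := (hball hx').1.2
      linarith [dist_triangle_right (h x) (h (φ a b x)) (h a)]
  · change dist (h.symm x) ((φ a b).symm (h.symm x)) ≤ ε
    have := hmove ((φ a b).symm (h.symm x))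
    rw [Homeomorph.apply_symm_apply] at this
    rcases this with hx | ⟨hx, hx'⟩
    · rw [← hx, dist_self]; exact hε.le
    · have h1 : dist ((φ a b).symm (h.symm x)) a < ε / 2 := (hball hx).1.1
      have h2 : dist (h.symm x) a < ε / 2 := (hball hx').1.1
      linarith [dist_triangle_right (h.symm x) ((φ a b).symm (h.symm x)) a]
  · change h (φ a b x) = h x
    rcases hmove x with hx' | ⟨hx', -⟩
    · rw [hx']
    · refine absurd ?_ (hball hx').2
      rcases hx with hx | hx | hx
      exacts [Or.inl (Or.inl hx), Or.inl (Or.inr hx), Or.inr hx]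
  · change a ∈ D ↔ h (φ a b a) ∈ E
    rw [hφ, hb]

/-- Two-sided version of `exists_homeomorph_adjust_point`: both `a` and the preimage of `a` are
added to the finite set of points where the correspondence between `D` and `E` holds. -/
theorem exists_homeomorph_adjust_point_symm {X : Type*} [MetricSpace X] {A D E F P : Set X}
    (hDA : D ⊆ A) (hD : Dense D) (hD' : Dense (A \ D))
    (hEA : E ⊆ A) (hE : Dense E) (hE' : Dense (A \ E))
    (φ : X → X → X ≃ₜ X) (hφ : ∀ a b, φ a b a = b)
    (hφd : ∀ a b x, φ a b x = x ∨ (dist x a < 2 * dist a b ∧ dist (φ a b x) a < 2 * dist a b))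
    (hA : ∀ a ∈ A, ∀ b ∈ A, ∀ x, φ a b x ∈ A ↔ x ∈ A)
    (hF : IsClosed F) (hFA : Disjoint F A) (hP : P.Finite)
    (h : X ≃ₜ X) (hh : ∀ x, h x ∈ A ↔ x ∈ A) (hPh : ∀ p ∈ P, p ∈ D ↔ h p ∈ E)
    {a : X} (ha : a ∈ A) {ε : ℝ} (hε : 0 < ε) :
    ∃ (h' : X ≃ₜ X) (P' : Set X), (∀ x, h' x ∈ A ↔ x ∈ A) ∧ P'.Finite ∧
      (∀ p ∈ P', p ∈ D ↔ h' p ∈ E) ∧ P ⊆ P' ∧ a ∈ P' ∧ h'.symm a ∈ P' ∧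
      (∀ x, dist (h x) (h' x) ≤ ε) ∧ (∀ x, dist (h.symm x) (h'.symm x) ≤ ε) ∧
      ∀ x, x ∈ F ∨ h x ∈ F ∨ x ∈ P → h' x = h x := by
  obtain ⟨g, hgA, hgd, hgd', hgeq, hga⟩ := exists_homeomorph_adjust_point hEA hE hE' φ hφ hφd hA
    hF hFA hP h hh hPh ha (half_pos hε)
  have hgP : ∀ p ∈ insert a P, p ∈ D ↔ g p ∈ E := by
    rintro p (rfl | hp)
    · exact hga
    · rw [hgeq p (Or.inr (Or.inr hp))]
      exact hPh p hp
  have hgA' : ∀ x, g.symm x ∈ A ↔ x ∈ A := fun x => by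
    rw [← hgA, Homeomorph.apply_symm_apply]
  obtain ⟨k, hkA, hkd, hkd', hkeq, hka⟩ := exists_homeomorph_adjust_point hDA hD hD' φ hφ hφd hA
    hF hFA ((hP.insert a).image g) g.symm hgA' (D := E) (by
      rintro _ ⟨p, hp, rfl⟩
      rw [Homeomorph.symm_apply_apply]
      exact (hgP p hp).symm) ha (half_pos hε)
  have hkg : ∀ x, x ∈ F ∨ g x ∈ F ∨ x ∈ insert a P → k.symm x = g x := by
    intro x hx
    rw [Homeomorph.symm_apply_eq, hkeq, Homeomorph.symm_apply_apply]
    rw [Homeomorph.symm_apply_apply]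
    rcases hx with hx | hx | hx
    exacts [Or.inr (Or.inl hx), Or.inl hx, Or.inr (Or.inr (mem_image_of_mem g hx))]
  refine ⟨k.symm, insert (k a) (insert a P), fun x => ?_, (hP.insert a).insert _, ?_,
    (subset_insert _ _).trans (subset_insert _ _), Or.inr (Or.inl rfl), Or.inl rfl,
    fun x => ?_, fun x => ?_, fun x hx => ?_⟩
  · rw [← hkA, Homeomorph.apply_symm_apply]
  · rintro p (rfl | hp)
    · rw [Homeomorph.symm_apply_apply]
      exact hka.symm
    · rw [hkg p (Or.inr (Or.inr hp))]
      exact hgP p hp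
  · have h1 := hgd x
    have h2 : dist (g x) (k.symm x) ≤ ε / 2 := hkd' x
    linarith [dist_triangle (h x) (g x) (k.symm x)]
  · have h1 := hgd' x
    have h2 : dist (g.symm x) (k x) ≤ ε / 2 := hkd x
    change dist (h.symm x) (k x) ≤ ε
    linarith [dist_triangle (h.symm x) (g.symm x) (k x)]
  · rw [← hgeq x hx]
    refine hkg x ?_
    rw [hgeq x hx]
    exact hx.imp_right (Or.imp_right (mem_insert_of_mem a))

/-- If `A` is a countable `Gδ`-set invariant under sufficiently many local homeomorphisms, then any
two dense and co-dense subsets of `A` are exchanged by a homeomorphism. -/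
theorem exists_homeomorph_image_eq_of_codense {X : Type*} [MetricSpace X] {A D E : Set X}
    (hAc : A.Countable) (hAG : IsGδ A)
    (hDA : D ⊆ A) (hD : Dense D) (hD' : Dense (A \ D))
    (hEA : E ⊆ A) (hE : Dense E) (hE' : Dense (A \ E))
    (φ : X → X → X ≃ₜ X) (hφ : ∀ a b, φ a b a = b)
    (hφd : ∀ a b x, φ a b x = x ∨ (dist x a < 2 * dist a b ∧ dist (φ a b x) a < 2 * dist a b))
    (hA : ∀ a ∈ A, ∀ b ∈ A, ∀ x, φ a b x ∈ A ↔ x ∈ A) :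
    ∃ f : X ≃ₜ X, f '' D = E := by
  rcases A.eq_empty_or_nonempty with hA0 | hAne
  · refine ⟨Homeomorph.refl X, ?_⟩
    rw [hA0, subset_empty_iff] at hDA hEA
    rw [hDA, hEA, image_empty]
  obtain ⟨a, ha⟩ := hAc.exists_eq_range hAne
  have haA : ∀ n, a n ∈ A := fun n => ha ▸ mem_range_self n
  obtain ⟨O, hO, hAO⟩ := hAG.eq_iInter_nat
  let K : ℕ → Set X := fun n => ⋃ i ∈ Iic n, (O i)ᶜ
  have hK : ∀ n, IsClosed (K n) := fun n =>
    (finite_Iic n).isClosed_biUnion fun i _ => (hO i).isClosed_compl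
  have hKmono : Monotone K := fun m n hmn => biUnion_mono (Iic_subset_Iic.2 hmn) fun _ _ => le_rfl
  have hKA : ∀ n, Disjoint (K n) A := by
    refine fun n => Set.disjoint_left.2 fun x hx hxA => ?_
    obtain ⟨i, -, hi⟩ := mem_iUnion₂.1 hx
    rw [hAO] at hxA
    exact hi (mem_iInter.1 hxA i)
  have hcover : ∀ x, (∃ n, a n = x) ∨ ∃ n, x ∈ K n := by
    intro x
    by_cases hx : x ∈ A
    · left
      rwa [ha] at hx
    · right
      rw [hAO, mem_iInter, not_forall] at hx
      obtain ⟨n, hn⟩ := hx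
      exact ⟨n, mem_biUnion (mem_Iic.2 le_rfl) hn⟩
  let State := {s : (X ≃ₜ X) × Set X //
    (∀ x, s.1 x ∈ A ↔ x ∈ A) ∧ s.2.Finite ∧ ∀ p ∈ s.2, p ∈ D ↔ s.1 p ∈ E}
  have step : ∀ (n : ℕ) (s : State), ∃ t : State, s.1.2 ⊆ t.1.2 ∧ a n ∈ t.1.2 ∧
      t.1.1.symm (a n) ∈ t.1.2 ∧ (∀ x, dist (s.1.1 x) (t.1.1 x) ≤ 1 * (1 / 2) ^ n) ∧
      (∀ x, dist (s.1.1.symm x) (t.1.1.symm x) ≤ 1 * (1 / 2) ^ n) ∧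
      ∀ x, x ∈ K n ∨ s.1.1 x ∈ K n ∨ x ∈ s.1.2 → t.1.1 x = s.1.1 x := by
    rintro n ⟨⟨h, P⟩, hh, hP, hPh⟩
    obtain ⟨h', P', h1, h2, h3, h4⟩ := exists_homeomorph_adjust_point_symm hDA hD hD' hEA hE hE'
      φ hφ hφd hA (hK n) (hKA n) hP h hh hPh (haA n) (show (0 : ℝ) < 1 * (1 / 2) ^ n by positivity)
    exact ⟨⟨⟨h', P'⟩, h1, h2, h3⟩, h4⟩
  choose next hPsub haP haP' hd hd' heq using step
  let s : ℕ → State := fun n =>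
    Nat.rec ⟨⟨Homeomorph.refl X, ∅⟩, fun x => Iff.rfl, finite_empty, fun p hp => hp.elim⟩ next n
  let h : ℕ → X ≃ₜ X := fun n => (s n).1.1
  let P : ℕ → Set X := fun n => (s n).1.2
  have hPmono : Monotone P := monotone_nat_of_le_succ fun n => hPsub n (s n)
  have hsucc : ∀ n x, x ∈ K n ∨ h n x ∈ K n ∨ x ∈ P n → h (n + 1) x = h n x :=
    fun n => heq n (s n)
  have hconst : ∀ N x, x ∈ K N ∨ h N x ∈ K N ∨ x ∈ P N → ∀ n ≥ N, h n x = h N x := by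
    intro N x hx n hn
    induction n, hn using Nat.le_induction with
    | base => rfl
    | succ n hn ih =>
      rw [hsucc n x ?_, ih]
      rw [ih]
      exact hx.imp (fun h => hKmono hn h) (Or.imp (fun h => hKmono hn h) fun h => hPmono hn h)
  obtain ⟨f, hf⟩ := exists_homeomorph_limit h (fun n => hd n (s n)) (fun n => hd' n (s n))
    (by
      intro x
      rcases hcover x with ⟨n, rfl⟩ | ⟨n, hn⟩
      · exact ⟨n + 1, hconst (n + 1) _ (Or.inr (Or.inr (haP n (s n))))⟩
      · exact ⟨n, hconst n x (Or.inl hn)⟩)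
    (by
      intro y
      have key : ∀ N, y ∈ K N ∨ (h N).symm y ∈ P N → ∀ n ≥ N, (h n).symm y = (h N).symm y := by
        intro N hN n hn
        rw [Homeomorph.symm_apply_eq, hconst N _ ?_ n hn, Homeomorph.apply_symm_apply]
        rw [Homeomorph.apply_symm_apply]
        exact Or.inr hN
      rcases hcover y with ⟨n, rfl⟩ | ⟨n, hn⟩
      · exact ⟨n + 1, key (n + 1) (Or.inr (haP' n (s n)))⟩
      · exact ⟨n, key n (Or.inl hn)⟩)
  have hfDE : ∀ x, x ∈ D ↔ f x ∈ E := by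
    intro x
    obtain ⟨N, hN⟩ := hf x
    rcases hcover x with ⟨m, rfl⟩ | ⟨m, hm⟩
    · rw [← hN (max N (m + 1)) (le_max_left _ _)]
      exact (s _).2.2.2 _ (hPmono (le_max_right N (m + 1)) (haP m (s m)))
    · have hxA : x ∉ A := (hKA m).notMem_of_mem_left hm
      refine iff_of_false (fun hx => hxA (hDA hx)) fun hx => hxA ?_
      rw [← hN N le_rfl] at hx
      exact ((s N).2.1 x).1 (hEA hx)
  refine ⟨f, subset_antisymm (image_subset_iff.2 fun x hx => (hfDE x).1 hx) fun y hy => ?_⟩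
  exact ⟨f.symm y, (hfDE _).2 (by rwa [Homeomorph.apply_symm_apply]), f.apply_symm_apply y⟩

/-- In a strongly homogeneous zero-dimensional uncountable space, every countable set has dense
complement. -/
theorem dense_compl_of_countable_of_stronglyHomogeneous {X : Type*} [TopologicalSpace X]
    (hz : ZeroDimensional X)
    (hsh : ∀ U V : Set X, IsClopen U → U.Nonempty → IsClopen V → V.Nonempty →
      Nonempty (↥U ≃ₜ ↥V))
    (hX : ¬ (univ : Set X).Countable) {S : Set X} (hS : S.Countable) : Dense Sᶜ := by
  obtain ⟨B, hB, hBc⟩ := hz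
  refine hB.dense_iff.2 fun V hV hVne => ?_
  by_contra hempty
  have hVS : V ⊆ S := fun x hx => by
    by_contra hxS
    exact hempty ⟨x, hx, hxS⟩
  obtain ⟨e⟩ := hsh V univ (hBc V hV) hVne isClopen_univ (hVne.mono (subset_univ V))
  have : Countable V := (hS.mono hVS).to_subtype
  exact hX (countable_coe_iff.1 e.symm.injective.countable)

/-- A strongly homogeneous λ-set in which every nowhere dense set can be moved (up to
homeomorphism) off any countable set is CDH. -/
theorem CDH_of_stronglyHomogeneous_lambda (X : Type*) [TopologicalSpace X]
    (hlam : IsLambdaSpace X)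
    (hsh : ∀ U V : Set X, IsClopen U → U.Nonempty → IsClopen V → V.Nonempty →
      Nonempty (↥U ≃ₜ ↥V))
    (hmove : ∀ A B : Set X, A.Countable → IsNowhereDense B →
      ∃ B' : Set X, IsNowhereDense B' ∧ Nonempty (↥B' ≃ₜ ↥B) ∧ A ∩ B' = ∅) :
    IsCDH X := by
  obtain ⟨hz, hsep, hmet, hG⟩ := hlam
  intro D E hDc hD hEc hE
  let : MetricSpace X := metrizableSpaceMetric X
  rcases subsingleton_or_nontrivial X with hX | hX
  · refine ⟨Homeomorph.refl X, ?_⟩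
    have huniv : ∀ T : Set X, Dense T → T = univ := fun T hT => eq_univ_of_forall fun x => by
      obtain ⟨y, hy⟩ := (have : Nonempty X := ⟨x⟩; hT.nonempty)
      exact Subsingleton.elim y x ▸ hy
    rw [huniv D hD, huniv E hE]
    exact image_id _
  have hiso : ∀ x : X, ¬ IsOpen ({x} : Set X) := by
    intro x hx
    obtain ⟨e⟩ := hsh {x} univ ⟨isClosed_singleton, hx⟩ (singleton_nonempty x) isClopen_univ
      univ_nonempty
    have : Subsingleton (univ : Set X) := e.symm.injective.subsingleton
    exact not_subsingleton X (subsingleton_univ_iff.1 (subsingleton_coe _ |>.1 this))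
  have hunc : ¬ (univ : Set X).Countable := by
    intro hc
    obtain ⟨x⟩ : Nonempty X := inferInstance
    have hnd : IsNowhereDense ({x} : Set X) := by
      rw [IsNowhereDense, closure_singleton]
      refine (subset_singleton_iff_eq.1 interior_subset).resolve_right fun h => ?_
      exact hiso x (h ▸ isOpen_interior)
    obtain ⟨B', -, ⟨e⟩, hB'⟩ := hmove univ {x} hc hnd
    rw [univ_inter] at hB'
    exact hB'.subset (e.symm ⟨x, rfl⟩).2
  have : SecondCountableTopology X := UniformSpace.secondCountable_of_separable X
  obtain ⟨C, hCsub, hCc, hC⟩ := (dense_compl_of_countable_of_stronglyHomogeneous hz hsh hunc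
    (hDc.union hEc)).exists_countable_dense_subset
  choose φ hφ hφd using exists_homeomorph_near hz hiso hsh
  obtain ⟨A, hSA, hAc, hA⟩ := exists_countable_invariant φ ((hDc.union hEc).union hCc)
  refine exists_homeomorph_image_eq_of_codense hAc (hG A hAc)
    (fun x hx => hSA (Or.inl (Or.inl hx))) hD
    (hC.mono fun x hx => ⟨hSA (Or.inr hx), fun h => hCsub hx (Or.inl h)⟩)
    (fun x hx => hSA (Or.inl (Or.inr hx))) hE
    (hC.mono fun x hx => ⟨hSA (Or.inr hx), fun h => hCsub hx (Or.inr h)⟩) φ hφ hφd hA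
end

section
/- Let X and Y be zero-dimensional separable metrizable spaces, let A ⊆ X and B ⊆ Y be nonempty closed nowhere dense subspaces, and let h : A → B be a homeomorphism. Then there exists a Knaster–Reichbach cover for ⟨X \ A, Y \ B, h⟩. -/
open Set TopologicalSpace

/-- `⟨𝒰, 𝒱, α⟩` is a Knaster–Reichbach cover for `⟨X \ A, Y \ B, h⟩`:
`𝒰` is a partition of `X \ A` into nonempty clopen subsets of `X`, `𝒱` is a partition of
`Y \ B` into nonempty clopen subsets of `Y`, `α` restricts to a bijection `𝒰 → 𝒱`, and
whenever a bijection `X → Y` is obtained by combining `h` with arbitrary bijections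
`U → α(U)` (`U ∈ 𝒰`), the combined map is continuous at every point of `A` and its
inverse is continuous at every point of `B`. -/
def IsKRCover {X Y : Type*} [TopologicalSpace X] [TopologicalSpace Y]
    (A : Set X) (B : Set Y) (h : ↥A ≃ₜ ↥B)
    (𝒰 : Set (Set X)) (𝒱 : Set (Set Y)) (α : Set X → Set Y) : Prop :=
  (∀ U ∈ 𝒰, U.Nonempty ∧ IsClopen U) ∧ 𝒰.PairwiseDisjoint id ∧ ⋃₀ 𝒰 = Aᶜ ∧
  (∀ V ∈ 𝒱, V.Nonempty ∧ IsClopen V) ∧ 𝒱.PairwiseDisjoint id ∧ ⋃₀ 𝒱 = Bᶜ ∧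
  Set.BijOn α 𝒰 𝒱 ∧
  ∀ F : X ≃ Y, (∀ a : ↥A, F ↑a = ↑(h a)) → (∀ U ∈ 𝒰, F '' U = α U) →
    (∀ a ∈ A, ContinuousAt F a) ∧ (∀ b ∈ B, ContinuousAt F.symm b)

open Filter Topology in
/-- A sequence of locally constant maps to finite types, each determined by the later ones, whose
fibres form a neighbourhood basis at every point. -/
structure IsCode {X : Type*} [TopologicalSpace X] (p : (n : ℕ) → X → Fin n → Prop) : Prop where
  locallyConstant : ∀ n, IsLocallyConstant (p n)
  mono : ∀ {m n : ℕ} {x y : X}, m ≤ n → p n x = p n y → p m x = p m y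
  basis : ∀ x, ∀ s ∈ 𝓝 x, ∃ n, ∀ y, p n y = p n x → y ∈ s

open Filter Topology in
/-- A level function and a map to `Z`, both used off the closed copy `range j` of `Z`, such that
points off `range j` converge to `j z` if and only if their levels tend to infinity and their images
converge to `z`; moreover every set of points sharing a level `n` and an `n`-th code is clopen, and
each code that occurs on `Z` also occurs at level `n`. -/
structure IsCollar {X Z : Type*} [TopologicalSpace X] [TopologicalSpace Z] (j : Z → X)
    (q : (n : ℕ) → Z → Fin n → Prop) (lev : X → ℕ) (r : X → Z) : Prop where
  isClopen : ∀ n t, IsClopen {x | x ∉ range j ∧ lev x = n ∧ q n (r x) = t}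
  nonempty : ∀ n z, ∃ x, x ∉ range j ∧ lev x = n ∧ q n (r x) = q n z
  tendsto_level : ∀ z, Tendsto lev (𝓝[(range j)ᶜ] (j z)) atTop
  tendsto_map : ∀ z, Tendsto r (𝓝[(range j)ᶜ] (j z)) (𝓝 z)
  comap_le : ∀ z, comap lev atTop ⊓ comap r (𝓝 z) ⊓ 𝓟 (range j)ᶜ ≤ 𝓝 (j z)

open Filter Topology in
theorem IsCode.eventually_eq {X : Type*} [TopologicalSpace X] {p : (n : ℕ) → X → Fin n → Prop}
    (hp : IsCode p) (n : ℕ) (x : X) : ∀ᶠ y in 𝓝 x, p n y = p n x :=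
  (IsLocallyConstant.iff_eventually_eq _).1 (hp.locallyConstant n) x

open Filter Topology in
theorem IsCode.comp {X Z : Type*} [TopologicalSpace X] [TopologicalSpace Z]
    {p : (n : ℕ) → X → Fin n → Prop} (hp : IsCode p) {j : Z → X} (hj : IsInducing j) :
    IsCode fun n z => p n (j z) where
  locallyConstant n := (hp.locallyConstant n).comp_continuous hj.continuous
  mono hmn h := hp.mono hmn h
  basis z s hs := by
    rw [hj.nhds_eq_comap] at hs
    obtain ⟨t, ht, hts⟩ := hs
    obtain ⟨n, hn⟩ := hp.basis _ t ht
    exact ⟨n, fun y hy => hts (hn _ hy)⟩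

open Filter Topology in
theorem ZeroDimensional.exists_isCode {X : Type*} [TopologicalSpace X]
    [SecondCountableTopology X] (hX : ZeroDimensional X) :
    ∃ p : (n : ℕ) → X → Fin n → Prop, IsCode p := by
  obtain ⟨b, hb, hclopen⟩ := hX
  obtain ⟨c, hcb, hc, hcbasis⟩ := hb.exists_countable
  rcases isEmpty_or_nonempty X with hE | ⟨⟨x₀⟩⟩
  · exact ⟨fun _ _ _ => True, fun n => IsLocallyConstant.const _, fun _ _ => rfl,
      fun x => isEmptyElim x⟩
  have hcne : c.Nonempty := by
    obtain ⟨s, hs, -⟩ := hcbasis.exists_subset_of_mem_open (mem_univ x₀) isOpen_univ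
    exact ⟨s, hs⟩
  obtain ⟨C, rfl⟩ := hc.exists_eq_range hcne
  have hC : ∀ i, IsClopen (C i) := fun i => hclopen _ (hcb (mem_range_self i))
  refine ⟨fun n x i => x ∈ C i, fun n => ?_, fun {m n x y} hmn h => ?_, fun x s hs => ?_⟩
  · rw [IsLocallyConstant.iff_eventually_eq]
    intro x
    have : ∀ i : Fin n, ∀ᶠ y in 𝓝 x, (y ∈ C i) = (x ∈ C i) := fun i => by
      by_cases hx : x ∈ C i
      · filter_upwards [(hC i).isOpen.mem_nhds hx] with y hy
        simp [hx, hy]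
      · filter_upwards [(hC i).compl.isOpen.mem_nhds hx] with y hy
        simpa [hx] using hy
    filter_upwards [eventually_all.2 this] with y hy
    exact funext hy
  · funext i
    exact congrFun h (Fin.castLE hmn i)
  · obtain ⟨_, ⟨i, rfl⟩, hxi, his⟩ := hcbasis.mem_nhds_iff.1 hs
    refine ⟨i + 1, fun y hy => his ?_⟩
    have := congrFun hy (Fin.last i)
    simp only [Fin.val_last] at this
    exact this.symm ▸ hxi

open Filter Topology in
/-- A depth function and a locally constant map off a closed copy of `Z`: points of large depth are
close to their images. -/
theorem IsCode.exists_depth {X Z : Type*} [TopologicalSpace X] [TopologicalSpace Z] [Nonempty Z]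
    {p : (n : ℕ) → X → Fin n → Prop} (hp : IsCode p) {j : Z → X} (hj : IsClosedEmbedding j) :
    ∃ (k : X → ℕ) (r : X → Z),
      (∀ x ∉ range j, ∀ᶠ y in 𝓝 x, y ∉ range j ∧ k y = k x ∧ r y = r x) ∧
      (∀ z, Tendsto k (𝓝[(range j)ᶜ] (j z)) atTop) ∧
      (∀ z, Tendsto r (𝓝[(range j)ᶜ] (j z)) (𝓝 z)) ∧
      ∀ x ∉ range j, p (k x) (j (r x)) = p (k x) x := by
  classical
  let near (n : ℕ) (x : X) : Prop := ∃ z, p n (j z) = p n x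
  have near_mono {m n x} (hmn : m ≤ n) : near n x → near m x :=
    fun ⟨z, hz⟩ => ⟨z, hp.mono hmn hz⟩
  have near_zero (x) : near 0 x := ⟨Classical.arbitrary Z, funext fun i => i.elim0⟩
  have hk (x) : ∃ k, x ∉ range j → ∀ n, near n x ↔ n ≤ k := by
    by_cases hx : x ∈ range j
    · exact ⟨0, fun h => absurd hx h⟩
    have hfar : ∃ n, ¬ near n x := by
      obtain ⟨n, hn⟩ := hp.basis x _ (hj.isClosed_range.isOpen_compl.mem_nhds hx)
      exact ⟨n, fun ⟨z, hz⟩ => hn _ hz (mem_range_self z)⟩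
    have hspec := Nat.find_spec hfar
    have hpos : Nat.find hfar ≠ 0 := fun h => by
      rw [h] at hspec
      exact hspec (near_zero x)
    refine ⟨Nat.find hfar - 1, fun _ n => ⟨fun hn => ?_, fun hn => ?_⟩⟩
    · by_contra hlt
      exact hspec (near_mono (by omega) hn)
    · exact not_not.1 (Nat.find_min hfar (m := n) (by omega))
  choose k hk using hk
  let g (n : ℕ) (t : Fin n → Prop) : Z :=
    if h : ∃ z, p n (j z) = t then h.choose else Classical.arbitrary Z
  have hg (n x) (h : near n x) : p n (j (g n (p n x))) = p n x := by
    have hdef : g n (p n x) = h.choose := dif_pos h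
    rw [hdef]
    exact h.choose_spec
  have hr (x) (hx : x ∉ range j) : p (k x) (j (g (k x) (p (k x) x))) = p (k x) x :=
    hg _ _ ((hk x hx _).2 le_rfl)
  have hnear (n z) : ∀ᶠ x in 𝓝[(range j)ᶜ] (j z), n ≤ k x ∧ p n x = p n (j z) := by
    filter_upwards [self_mem_nhdsWithin,
      mem_nhdsWithin_of_mem_nhds (hp.eventually_eq n (j z))] with x hx hxz
    exact ⟨(hk x hx n).1 ⟨z, hxz.symm⟩, hxz⟩
  refine ⟨k, fun x => g (k x) (p (k x) x), fun x hx => ?_, fun z => ?_, fun z => ?_, hr⟩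
  · filter_upwards [hj.isClosed_range.isOpen_compl.mem_nhds hx,
      hp.eventually_eq (k x + 1) x] with y hy hyx
    have hyx' : p (k x) y = p (k x) x := hp.mono (Nat.le_succ _) hyx
    have h₁ : k x ≤ k y := by
      obtain ⟨z, hz⟩ := (hk x hx _).2 le_rfl
      exact (hk y hy _).1 ⟨z, hz.trans hyx'.symm⟩
    have h₂ : k y ≤ k x := by
      by_contra hlt
      obtain ⟨z, hz⟩ := (hk y hy (k x + 1)).2 (by omega)
      have := (hk x hx _).1 ⟨z, hz.trans hyx⟩
      omega
    have h₃ : k y = k x := le_antisymm h₂ h₁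
    refine ⟨hy, h₃, ?_⟩
    rw [h₃, hyx']
  · exact tendsto_atTop.2 fun n => (hnear n z).mono fun x hx => hx.1
  · rw [hj.isInducing.tendsto_nhds_iff]
    intro s hs
    obtain ⟨n, hn⟩ := hp.basis _ s hs
    have hev : ∀ᶠ x in 𝓝[(range j)ᶜ] (j z), j (g (k x) (p (k x) x)) ∈ s := by
      filter_upwards [self_mem_nhdsWithin, hnear n z] with x hx hxz
      exact hn _ ((hp.mono hxz.1 (hr x hx)).trans hxz.2)
    exact hev

open Filter Topology in
theorem IsCode.exists_isCollar {X Z : Type*} [TopologicalSpace X] [TopologicalSpace Z] [Nonempty Z]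
    {p : (n : ℕ) → X → Fin n → Prop} (hp : IsCode p) {j : Z → X} (hj : IsClosedEmbedding j)
    (hd : Dense (range j)ᶜ) {q : (n : ℕ) → Z → Fin n → Prop} (hq : IsCode q) :
    ∃ (lev : X → ℕ) (r : X → Z), IsCollar j q lev r := by
  obtain ⟨k, r, hloc, hk, hr, hkr⟩ := hp.exists_depth hj
  have step (n t : ℕ) : ∃ t' > t, ∀ z, ∃ x ∉ range j, t ≤ k x ∧ k x < t' ∧ q n (r x) = q n z := by
    have hpt (s : Fin n → Prop) : ∃ x, s ∈ range (q n) → x ∉ range j ∧ t ≤ k x ∧ q n (r x) = s := by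
      by_cases hs : s ∈ range (q n)
      · obtain ⟨z, rfl⟩ := hs
        have : (𝓝[(range j)ᶜ] (j z)).NeBot := mem_closure_iff_nhdsWithin_neBot.1 (hd (j z))
        obtain ⟨x, hx, htx, hxz⟩ := ((eventually_mem_nhdsWithin (a := j z) (s := (range j)ᶜ)).and
          (((hk z).eventually_ge_atTop t).and ((hr z).eventually (hq.eventually_eq n z)))).exists
        exact ⟨x, fun _ => ⟨hx, htx, hxz⟩⟩
      · exact ⟨j (Classical.arbitrary Z), fun h => absurd h hs⟩
    choose x hx using hpt
    obtain ⟨M, hM⟩ := (Set.finite_range fun s => k (x s)).bddAbove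
    refine ⟨max t M + 1, by omega, fun z => ?_⟩
    obtain ⟨h₁, h₂, h₃⟩ := hx (q n z) (mem_range_self z)
    have h₄ : k (x (q n z)) ≤ M := hM (mem_range_self (q n z))
    exact ⟨x (q n z), h₁, h₂, by omega, h₃⟩
  choose f hf hfx using step
  let θ : ℕ → ℕ := fun n => Nat.rec 0 f n
  have hθ : StrictMono θ := strictMono_nat_of_lt_succ fun n => hf n (θ n)
  have hL (t : ℕ) : ∃ m, θ m ≤ t ∧ t < θ (m + 1) := by
    induction t with
    | zero => exact ⟨0, le_rfl, hf 0 0⟩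
    | succ t ih =>
      obtain ⟨m, h₁, h₂⟩ := ih
      rcases (Nat.succ_le_of_lt h₂).lt_or_eq with h | h
      · exact ⟨m, by omega, h⟩
      · exact ⟨m + 1, h.ge, lt_of_eq_of_lt h (hθ (Nat.lt_succ_self (m + 1)))⟩
  choose L hL₁ hL₂ using hL
  have hle (n t) : n ≤ L t ↔ θ n ≤ t := by
    refine ⟨fun h => (hθ.monotone h).trans (hL₁ t), fun h => ?_⟩
    exact Nat.lt_succ_iff.1 (hθ.lt_iff_lt.1 (h.trans_lt (hL₂ t)))
  have hLt (z) : Tendsto (fun x => L (k x)) (𝓝[(range j)ᶜ] (j z)) atTop :=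
    tendsto_atTop.2 fun n => ((hk z).eventually_ge_atTop (θ n)).mono fun x hx => (hle n _).2 hx
  refine ⟨fun x => L (k x), r, fun n t => ⟨?_, ?_⟩, fun n z => ?_, hLt, hr, fun z s hs => ?_⟩
  · rw [← isOpen_compl_iff, isOpen_iff_mem_nhds]
    intro x hx
    by_cases hxj : x ∈ range j
    · obtain ⟨z, rfl⟩ := hxj
      filter_upwards [eventually_nhdsWithin_iff.1 ((hLt z).eventually_gt_atTop n)] with y hy
      rintro ⟨h₁, h₂, -⟩
      exact (hy h₁).ne' h₂
    · filter_upwards [hloc x hxj] with y ⟨_, h₂, h₃⟩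
      rintro ⟨_, h₄, h₅⟩
      exact hx ⟨hxj, by rw [← h₂]; exact h₄, by rw [← h₃]; exact h₅⟩
  · rw [isOpen_iff_mem_nhds]
    rintro x ⟨hxj, h₄, h₅⟩
    filter_upwards [hloc x hxj] with y ⟨h₁, h₂, h₃⟩
    exact ⟨h₁, by rw [h₂]; exact h₄, by rw [h₃]; exact h₅⟩
  · obtain ⟨x, h₁, h₂, h₃, h₄⟩ := hfx n (θ n) z
    refine ⟨x, h₁, le_antisymm ?_ ((hle n _).2 h₂), h₄⟩
    by_contra hlt
    exact absurd ((hle (n + 1) (k x)).1 (by omega)) (not_le.2 h₃)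
  · obtain ⟨n, hn⟩ := hp.basis _ s hs
    have h₁ : ∀ᶠ x in comap (fun x => L (k x)) atTop, n ≤ L (k x) :=
      tendsto_comap.eventually_ge_atTop n
    have h₂ : ∀ᶠ x in comap r (𝓝 z), p n (j (r x)) = p n (j z) :=
      tendsto_comap.eventually (hj.continuous.continuousAt.eventually (hp.eventually_eq n (j z)))
    filter_upwards [inter_mem_inf (inter_mem_inf h₁ h₂) (mem_principal_self (range j)ᶜ)] with
      x ⟨⟨hx₁, hx₂⟩, hx₃⟩
    exact hn x ((hp.mono ((hθ.id_le n).trans ((hle n _).1 hx₁)) (hkr x hx₃)).symm.trans hx₂)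

open Filter Topology in
/-- A map that matches the levels and codes of two collars of `Z` is continuous along `Z`. -/
theorem IsCollar.continuousAt {X Y Z : Type*} [TopologicalSpace X] [TopologicalSpace Y]
    [TopologicalSpace Z] {j : Z → X} {j' : Z → Y} (hj : IsInducing j) (hj' : Continuous j')
    {q : (n : ℕ) → Z → Fin n → Prop} (hq : IsCode q) {lev : X → ℕ} {r : X → Z} {lev' : Y → ℕ}
    {r' : Y → Z} (hX : IsCollar j q lev r) (hY : IsCollar j' q lev' r') {F : X → Y}
    (hF : ∀ z, F (j z) = j' z)
    (hFc : ∀ x ∉ range j, F x ∉ range j' ∧ lev' (F x) = lev x ∧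
      q (lev x) (r' (F x)) = q (lev x) (r x)) (z : Z) :
    ContinuousAt F (j z) := by
  have hsup : 𝓝 (j z) = 𝓝[range j] (j z) ⊔ 𝓝[(range j)ᶜ] (j z) := by
    rw [← nhdsWithin_union, union_compl_self, nhdsWithin_univ]
  rw [ContinuousAt, hsup, tendsto_sup]
  constructor
  · rw [← hj.map_nhds_eq, tendsto_map'_iff, hF z]
    exact (hj'.tendsto z).congr fun w => (hF w).symm
  · rw [hF z]
    refine Tendsto.mono_right ?_ (hY.comap_le z)
    rw [tendsto_inf, tendsto_inf, tendsto_comap_iff, tendsto_comap_iff, tendsto_principal]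
    have hmem : ∀ᶠ x in 𝓝[(range j)ᶜ] (j z), x ∉ range j := self_mem_nhdsWithin
    refine ⟨⟨?_, fun s hs => ?_⟩, hmem.mono fun x hx => (hFc x hx).1⟩
    · exact (hX.tendsto_level z).congr' (hmem.mono fun x hx => (hFc x hx).2.1.symm)
    · obtain ⟨n, hn⟩ := hq.basis z s hs
      have hev : ∀ᶠ x in 𝓝[(range j)ᶜ] (j z), r' (F x) ∈ s := by
        filter_upwards [hmem, (hX.tendsto_level z).eventually_ge_atTop n,
          (hX.tendsto_map z).eventually (hq.eventually_eq n z)] with x hx hlev hxz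
        exact hn _ ((hq.mono hlev (hFc x hx).2.2).trans hxz)
      exact hev

/-- The pieces of a collar, indexed by the levels and the codes occurring on `Z`. -/
def collarPiece {X Z : Type*} (j : Z → X) (q : (n : ℕ) → Z → Fin n → Prop) (lev : X → ℕ)
    (r : X → Z) (i : Σ n, range (q n)) : Set X :=
  {x | x ∉ range j ∧ lev x = i.1 ∧ q i.1 (r x) = i.2}

theorem mem_collarPiece {X Z : Type*} {j : Z → X} {q : (n : ℕ) → Z → Fin n → Prop} {lev : X → ℕ}
    {r : X → Z} {i : Σ n, range (q n)} {x : X} :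
    x ∈ collarPiece j q lev r i ↔
      x ∉ range j ∧ i = ⟨lev x, q (lev x) (r x), mem_range_self _⟩ := by
  obtain ⟨n, t, ht⟩ := i
  refine and_congr_right fun _ => ⟨?_, fun h => ?_⟩
  · rintro ⟨rfl, h⟩
    exact Sigma.ext rfl (heq_of_eq (Subtype.ext h.symm))
  · obtain ⟨rfl, h⟩ := Sigma.mk.inj_iff.1 h
    exact ⟨rfl, (congrArg Subtype.val (eq_of_heq h)).symm⟩

theorem collarPiece_disjoint {X Z : Type*} {j : Z → X} {q : (n : ℕ) → Z → Fin n → Prop}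
    {lev : X → ℕ} {r : X → Z} {i i' : Σ n, range (q n)} (hi : i ≠ i') :
    Disjoint (collarPiece j q lev r i) (collarPiece j q lev r i') :=
  disjoint_left.2 fun _ hx hx' =>
    hi ((mem_collarPiece.1 hx).2.trans (mem_collarPiece.1 hx').2.symm)

theorem iUnion_collarPiece {X Z : Type*} {j : Z → X} {q : (n : ℕ) → Z → Fin n → Prop}
    {lev : X → ℕ} {r : X → Z} : ⋃ i, collarPiece j q lev r i = (range j)ᶜ := by
  ext x
  simp [mem_collarPiece]

theorem IsCollar.collarPiece_nonempty {X Z : Type*} [TopologicalSpace X] [TopologicalSpace Z]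
    {j : Z → X} {q : (n : ℕ) → Z → Fin n → Prop} {lev : X → ℕ} {r : X → Z}
    (hX : IsCollar j q lev r) (i : Σ n, range (q n)) : (collarPiece j q lev r i).Nonempty := by
  obtain ⟨n, _, z, rfl⟩ := i
  exact hX.nonempty n z

theorem IsCollar.collarPiece_injective {X Z : Type*} [TopologicalSpace X] [TopologicalSpace Z]
    {j : Z → X} {q : (n : ℕ) → Z → Fin n → Prop} {lev : X → ℕ} {r : X → Z}
    (hX : IsCollar j q lev r) : Function.Injective (collarPiece j q lev r) := fun i i' h => by
  obtain ⟨x, hx⟩ := hX.collarPiece_nonempty i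
  exact (mem_collarPiece.1 hx).2.trans (mem_collarPiece.1 (h ▸ hx)).2.symm

theorem IsCollar.continuousAt_of_collarPiece {X Y Z : Type*} [TopologicalSpace X]
    [TopologicalSpace Y] [TopologicalSpace Z] {j : Z → X} {j' : Z → Y}
    (hj : Topology.IsInducing j) (hj' : Continuous j') {q : (n : ℕ) → Z → Fin n → Prop}
    (hq : IsCode q) {lev : X → ℕ} {r : X → Z} {lev' : Y → ℕ} {r' : Y → Z}
    (hX : IsCollar j q lev r) (hY : IsCollar j' q lev' r') {F : X → Y}
    (hF : ∀ z, F (j z) = j' z)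
    (hFp : ∀ i, MapsTo F (collarPiece j q lev r i) (collarPiece j' q lev' r' i)) (z : Z) :
    ContinuousAt F (j z) := by
  refine hX.continuousAt hj hj' hq hY hF (fun x hx => ?_) z
  exact hFp ⟨lev x, q (lev x) (r x), mem_range_self _⟩ ⟨hx, rfl, rfl⟩

/-- Existence of Knaster–Reichbach covers: for zero-dimensional separable metrizable
`X`, `Y`, nonempty closed nowhere dense `A ⊆ X`, `B ⊆ Y` and a homeomorphism
`h : A → B`, there is a KR-cover for `⟨X \ A, Y \ B, h⟩`. -/
theorem exists_KRCover (X Y : Type*) [TopologicalSpace X] [TopologicalSpace Y]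
    [SeparableSpace X] [MetrizableSpace X] [SeparableSpace Y] [MetrizableSpace Y]
    (hX0 : ZeroDimensional X) (hY0 : ZeroDimensional Y)
    (A : Set X) (B : Set Y)
    (hAne : A.Nonempty) (hAcl : IsClosed A) (hAnd : IsNowhereDense A)
    (hBne : B.Nonempty) (hBcl : IsClosed B) (hBnd : IsNowhereDense B)
    (h : ↥A ≃ₜ ↥B) :
    ∃ (𝒰 : Set (Set X)) (𝒱 : Set (Set Y)) (α : Set X → Set Y),
      IsKRCover A B h 𝒰 𝒱 α := by
  have : Nonempty A := hAne.to_subtype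
  have : SecondCountableTopology X := by
    let _ := metrizableSpaceMetric X
    exact UniformSpace.secondCountable_of_separable X
  have : SecondCountableTopology Y := by
    let _ := metrizableSpaceMetric Y
    exact UniformSpace.secondCountable_of_separable Y
  obtain ⟨p, hp⟩ := hX0.exists_isCode
  obtain ⟨p', hp'⟩ := hY0.exists_isCode
  let j : A → X := Subtype.val
  let j' : A → Y := fun a => h a
  have hj : Topology.IsClosedEmbedding j := hAcl.isClosedEmbedding_subtypeVal
  have hj' : Topology.IsClosedEmbedding j' :=
    hBcl.isClosedEmbedding_subtypeVal.comp h.isClosedEmbedding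
  have hrange : range j = A := Subtype.range_coe
  have hrange' : range j' = B :=
    (h.surjective.range_comp (Subtype.val : B → Y)).trans Subtype.range_coe
  have hd : Dense (range j)ᶜ := by
    rw [hrange, ← interior_eq_empty_iff_dense_compl, ← hAcl.closure_eq]
    exact hAnd
  have hd' : Dense (range j')ᶜ := by
    rw [hrange', ← interior_eq_empty_iff_dense_compl, ← hBcl.closure_eq]
    exact hBnd
  have hq := hp.comp hj.isInducing
  obtain ⟨lev, r, hX⟩ := hp.exists_isCollar hj hd hq
  obtain ⟨lev', r', hY⟩ := hp'.exists_isCollar hj' hd' hq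
  set U := collarPiece j (fun n z => p n (j z)) lev r
  set V := collarPiece j' (fun n z => p n (j z)) lev' r'
  have hUinj : Function.Injective U := hX.collarPiece_injective
  have hVinj : Function.Injective V := hY.collarPiece_injective
  have hα (i) : V (Function.invFun U (U i)) = V i := by
    rw [Function.leftInverse_invFun hUinj i]
  refine ⟨range U, range V, fun W => V (Function.invFun U W), ?_, ?_, ?_, ?_, ?_, ?_, ?_, ?_⟩
  · rintro _ ⟨i, rfl⟩
    exact ⟨hX.collarPiece_nonempty i, hX.isClopen _ _⟩
  · rintro _ ⟨i, rfl⟩ _ ⟨i', rfl⟩ hne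
    exact collarPiece_disjoint fun h => hne (congrArg U h)
  · rw [sUnion_range]
    exact iUnion_collarPiece.trans (congrArg _ hrange)
  · rintro _ ⟨i, rfl⟩
    exact ⟨hY.collarPiece_nonempty i, hY.isClopen _ _⟩
  · rintro _ ⟨i, rfl⟩ _ ⟨i', rfl⟩ hne
    exact collarPiece_disjoint fun h => hne (congrArg V h)
  · rw [sUnion_range]
    exact iUnion_collarPiece.trans (congrArg _ hrange')
  · refine ⟨fun _ _ => mem_range_self _, ?_, ?_⟩
    · rintro _ ⟨i, rfl⟩ _ ⟨i', rfl⟩ hii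
      simp only [hα] at hii
      rw [hVinj hii]
    · rintro _ ⟨i, rfl⟩
      exact ⟨U i, mem_range_self i, hα i⟩
  · intro F hFA hFU
    have hFi (i) : F '' U i = V i := (hFU _ (mem_range_self i)).trans (hα i)
    constructor
    · intro a ha
      exact hX.continuousAt_of_collarPiece hj.isInducing hj'.continuous hq hY hFA
        (fun i => mapsTo_iff_image_subset.2 (hFi i).subset) ⟨a, ha⟩
    · intro b hb
      rw [← hrange'] at hb
      obtain ⟨a, rfl⟩ := hb
      refine hY.continuousAt_of_collarPiece hj'.isInducing hj.continuous hq hX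
        (fun z => F.symm_apply_eq.2 (hFA z).symm) (fun i y hy => ?_) a
      obtain ⟨x, hx, rfl⟩ := (hFi i).superset hy
      rwa [F.symm_apply_apply]
end

section
/- Let X ⊆ Y ⊆ 2^ω \ Q and let h : 𝔸(X) → 𝔸(X) be a homeomorphism that is monotone at each point of the form ⟨x, 0⟩ with x ∈ Y \ X and satisfies h[(Y \ X) × {0}] = (Y \ X) × {0}. Then there exists a homeomorphism H : 𝔸(Y) → 𝔸(Y) such that π_X^Y ∘ H = h ∘ π_X^Y. -/
open Set

/-- The Cantor space `2^ω`. -/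
abbrev Cantor : Type := ℕ → Bool

/-- The (strict) lexicographic order on the Cantor space. -/
def CLt (x y : Cantor) : Prop :=
  ∃ n : ℕ, (∀ m, m < n → x m = y m) ∧ x n = false ∧ y n = true

/-- The points of `2^ω` eventually equal to `0`. -/
def Q0 : Set Cantor := {x | ∃ n, ∀ m, n ≤ m → x m = false}

/-- The points of `2^ω` eventually equal to `1`. -/
def Q1 : Set Cantor := {x | ∃ n, ∀ m, n ≤ m → x m = true}

/-- `Q = Q₀ ∪ Q₁`. -/
def QSet : Set Cantor := Q0 ∪ Q1

/-- The strict lexicographic order on `2^ω × {0,1}` (with `false < true`). -/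
def ALt (p q : Cantor × Bool) : Prop :=
  CLt p.1 q.1 ∨ (p.1 = q.1 ∧ p.2 = false ∧ q.2 = true)

/-- The double arrow space over `X ⊆ 2^ω \ Q`, as a subset of `2^ω × {0,1}`. -/
def DoubleArrow (X : Set Cantor) : Set (Cantor × Bool) :=
  (Q0ᶜ ×ˢ ({false} : Set Bool)) ∪ ((Q0 ∪ X) ×ˢ ({true} : Set Bool))

/-- The order topology of a strict order `lt`: generated by the open rays. -/
def ordTop {α : Type*} (lt : α → α → Prop) : TopologicalSpace α :=
  TopologicalSpace.generateFrom
    ({s | ∃ a, s = {x | lt a x}} ∪ {s | ∃ a, s = {x | lt x a}})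

/-- The lexicographic order restricted to the double arrow space. -/
def arrowLt (X : Set Cantor) (p q : ↥(DoubleArrow X)) : Prop := ALt ↑p ↑q

/-- The double arrow space carries the order topology of the lexicographic order. -/
def arrowTop (X : Set Cantor) : TopologicalSpace ↥(DoubleArrow X) := ordTop (arrowLt X)

/-- `f` is monotone at `x` with respect to the strict order `lt`: there are `a < x < b`
such that `f` maps `(a,x)` and `(x,b)` into the corresponding open rays at `f x`,
either preserving or reversing sides. -/
def MonotoneAtRel {α : Type*} (lt : α → α → Prop) (f : α → α) (x : α) : Prop :=
  ∃ a b, lt a x ∧ lt x b ∧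
    (((∀ z, lt a z → lt z x → lt (f z) (f x)) ∧ (∀ z, lt x z → lt z b → lt (f x) (f z))) ∨
     ((∀ z, lt a z → lt z x → lt (f x) (f z)) ∧ (∀ z, lt x z → lt z b → lt (f z) (f x))))

open Classical in
/-- The natural projection on the ambient space `2^ω × {0,1}`: points whose first
coordinate survives in `Q₀ ∪ X` are kept, all others are collapsed to lower points. -/
noncomputable def projAmb (X : Set Cantor) (p : Cantor × Bool) : Cantor × Bool :=
  if p.1 ∈ Q0 ∪ X then p else (p.1, false)

theorem projAmb_mem {X Y : Set Cantor} (hXY : X ⊆ Y)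
    {p : Cantor × Bool} (hp : p ∈ DoubleArrow Y) : projAmb X p ∈ DoubleArrow X := by
  classical
  unfold projAmb
  by_cases hmem : p.1 ∈ Q0 ∪ X
  · rw [if_pos hmem]
    rcases hp with h | h
    · exact Or.inl h
    · exact Or.inr ⟨hmem, h.2⟩
  · rw [if_neg hmem]
    refine Or.inl ⟨?_, rfl⟩
    exact fun hq => hmem (Or.inl hq)

/-- The projection `π_X^Y : 𝔸(Y) → 𝔸(X)` for `X ⊆ Y ⊆ 2^ω \ Q`; it maps `⟨x,t⟩` to
`⟨x,0⟩` when `x ∈ Y \ X` and keeps the point otherwise. -/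
noncomputable def arrowProj (X Y : Set Cantor) (hXY : X ⊆ Y)
    (p : ↥(DoubleArrow Y)) : ↥(DoubleArrow X) :=
  ⟨projAmb X ↑p, projAmb_mem hXY p.2⟩

open Filter Topology

/-- The linear order `A` with every point of `S` split into two consecutive points. -/
def SplitOrder {A : Type*} (S : Set A) : Type _ :=
  {q : A ×ₗ Bool // (ofLex q).2 = true → (ofLex q).1 ∈ S}

namespace SplitOrder

variable {A : Type*} {S : Set A}

/-- The point of the split order with given position and side. -/
def mk (a : A) (t : Bool) (h : t = true → a ∈ S) : SplitOrder S := ⟨toLex (a, t), h⟩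

/-- The underlying point of the original order. -/
def fst (p : SplitOrder S) : A := (ofLex p.1).1

/-- The side: `false` for the lower copy (or the only copy), `true` for the upper copy. -/
def snd (p : SplitOrder S) : Bool := (ofLex p.1).2

theorem fst_mem (p : SplitOrder S) (h : p.snd = true) : p.fst ∈ S := p.2 h

@[simp] theorem fst_mk (a : A) (t : Bool) (h : t = true → a ∈ S) : (mk a t h).fst = a := rfl

@[simp] theorem snd_mk (a : A) (t : Bool) (h : t = true → a ∈ S) : (mk a t h).snd = t := rfl

theorem ext {p q : SplitOrder S} (h₁ : p.fst = q.fst) (h₂ : p.snd = q.snd) : p = q :=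
  Subtype.ext (ofLex.injective (Prod.ext h₁ h₂))

open Classical in
/-- The permutation of the split order induced by a permutation `h` of `A` preserving `S`;
the two copies of a point of `S` are exchanged when the point lies in `F`. -/
noncomputable def lift (h : A ≃ A) (hS : ∀ a, h a ∈ S ↔ a ∈ S) {F : Set A} (hF : F ⊆ S) :
    SplitOrder S ≃ SplitOrder S where
  toFun p := mk (h p.fst) (xor p.snd (decide (p.fst ∈ F))) fun ht => by
    rw [hS]
    by_cases hp : p.fst ∈ F
    · exact hF hp
    · exact p.fst_mem (by simpa [hp] using ht)
  invFun p := mk (h.symm p.fst) (xor p.snd (decide (h.symm p.fst ∈ F))) fun ht => by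
    by_cases hp : h.symm p.fst ∈ F
    · exact hF hp
    · rw [← hS, h.apply_symm_apply]
      exact p.fst_mem (by simpa [hp] using ht)
  left_inv p := ext (by simp) (by simp)
  right_inv p := ext (by simp) (by by_cases hp : h.symm p.fst ∈ F <;> simp [hp])

theorem snd_lift_of_mem (h : A ≃ A) (hS : ∀ a, h a ∈ S ↔ a ∈ S) {F : Set A} (hF : F ⊆ S)
    {p : SplitOrder S} (hp : p.fst ∈ F) : ((lift h hS hF) p).snd = !p.snd := by
  simp [lift, hp]

theorem snd_lift_of_notMem (h : A ≃ A) (hS : ∀ a, h a ∈ S ↔ a ∈ S) {F : Set A} (hF : F ⊆ S)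
    {p : SplitOrder S} (hp : p.fst ∉ F) : ((lift h hS hF) p).snd = p.snd := by
  simp [lift, hp]

theorem snd_lift_symm_of_mem (h : A ≃ A) (hS : ∀ a, h a ∈ S ↔ a ∈ S) {F : Set A} (hF : F ⊆ S)
    {p : SplitOrder S} (hp : h.symm p.fst ∈ F) : ((lift h hS hF).symm p).snd = !p.snd := by
  simp [lift, hp]

theorem snd_lift_symm_of_notMem (h : A ≃ A) (hS : ∀ a, h a ∈ S ↔ a ∈ S) {F : Set A} (hF : F ⊆ S)
    {p : SplitOrder S} (hp : h.symm p.fst ∉ F) : ((lift h hS hF).symm p).snd = p.snd := by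
  simp [lift, hp]

variable [LinearOrder A]

noncomputable instance : LinearOrder (SplitOrder S) :=
  inferInstanceAs (LinearOrder {q : A ×ₗ Bool // (ofLex q).2 = true → (ofLex q).1 ∈ S})

noncomputable instance : TopologicalSpace (SplitOrder S) := Preorder.topology _

instance : OrderTopology (SplitOrder S) := ⟨rfl⟩

theorem lt_iff {p q : SplitOrder S} :
    p < q ↔ p.fst < q.fst ∨ p.fst = q.fst ∧ p.snd = false ∧ q.snd = true := by
  rw [← Bool.lt_iff]
  exact Prod.Lex.lt_iff

variable [TopologicalSpace A] [OrderTopology A]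

theorem continuous_fst : Continuous (fst : SplitOrder S → A) := by
  classical
  refine OrderTopology.continuous_iff.2 fun a => ⟨?_, ?_⟩
  · convert isOpen_Ioi (a := mk (S := S) a (decide (a ∈ S)) (by simp)) using 1
    ext p
    have := p.fst_mem
    simp only [mem_preimage, mem_Ioi, lt_iff, fst_mk, snd_mk, decide_eq_false_iff_not]
    grind
  · convert isOpen_Iio (a := mk (S := S) a false (by simp)) using 1
    ext p
    simp [lt_iff]

/-- A map of the split order is continuous if it covers a continuous map which, locally at each
point of `S`, preserves sides (off `F`) or reverses sides (on `F`), in accordance with what the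
map does to the two copies of that point. -/
theorem continuous_of_covers {h : A → A} (hc : Continuous h) (hS : ∀ a, h a ∈ S ↔ a ∈ S)
    {F : Set A}
    (hinc : ∀ s ∈ S, s ∉ F → ∀ᶠ z in 𝓝 s, (z < s → h z < h s) ∧ (s < z → h s < h z))
    (hdec : ∀ s ∈ S, s ∈ F → ∀ᶠ z in 𝓝 s, (z < s → h s < h z) ∧ (s < z → h z < h s))
    {H : SplitOrder S → SplitOrder S} (hfst : ∀ p, (H p).fst = h p.fst)
    (hsnd_off : ∀ p, p.fst ∉ F → (H p).snd = p.snd)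
    (hsnd_on : ∀ p, p.fst ∈ F → (H p).snd = !p.snd) : Continuous H := by
  have hcf : Continuous fun p : SplitOrder S => h p.fst := hc.comp continuous_fst
  have key : ∀ p : SplitOrder S, p.fst ∈ S →
      (∀ᶠ q in 𝓝 p, (H p).snd = true → (H p).fst < (H q).fst ∨ H q = H p) ∧
      (∀ᶠ q in 𝓝 p, (H p).snd = false → (H q).fst < (H p).fst ∨ H q = H p) := by
    intro p hp
    have hup : p.snd = true → ∀ᶠ q in 𝓝 p, p.fst < q.fst ∨ q = p := by
      intro ht
      filter_upwards [lt_mem_nhds (show mk p.fst false (by simp) < p from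
        lt_iff.2 (Or.inr ⟨rfl, rfl, ht⟩))] with q hq
      rcases lt_iff.1 hq with hq | ⟨hq, -, hq'⟩
      · exact Or.inl hq
      · exact Or.inr (ext hq.symm (hq'.trans ht.symm))
    have hdown : p.snd = false → ∀ᶠ q in 𝓝 p, q.fst < p.fst ∨ q = p := by
      intro ht
      filter_upwards [gt_mem_nhds (show p < mk p.fst true (fun _ => hp) from
        lt_iff.2 (Or.inr ⟨rfl, ht, rfl⟩))] with q hq
      rcases lt_iff.1 hq with hq | ⟨hq, hq', -⟩
      · exact Or.inl hq
      · exact Or.inr (ext hq (hq'.trans ht.symm))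
    simp only [hfst]
    by_cases hpF : p.fst ∈ F
    · have hmono := continuous_fst.continuousAt.eventually (hdec _ hp hpF)
      rw [hsnd_on p hpF]
      cases ht : p.snd
      · refine ⟨?_, by simp⟩
        filter_upwards [hmono, hdown ht] with q hq hq' _
        exact hq'.imp hq.1 (congrArg H)
      · refine ⟨by simp, ?_⟩
        filter_upwards [hmono, hup ht] with q hq hq' _
        exact hq'.imp hq.2 (congrArg H)
    · have hmono := continuous_fst.continuousAt.eventually (hinc _ hp hpF)
      rw [hsnd_off p hpF]
      cases ht : p.snd
      · refine ⟨by simp, ?_⟩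
        filter_upwards [hmono, hdown ht] with q hq hq' _
        exact hq'.imp hq.1 (congrArg H)
      · refine ⟨?_, by simp⟩
        filter_upwards [hmono, hup ht] with q hq hq' _
        exact hq'.imp hq.2 (congrArg H)
  refine continuous_iff_continuousAt.2 fun p => tendsto_order.2 ⟨fun b hb => ?_, fun b hb => ?_⟩
  · rcases lt_iff.1 hb with hlt | ⟨heq, -, ht⟩
    · rw [hfst] at hlt
      filter_upwards [hcf.continuousAt.eventually (lt_mem_nhds hlt)] with q hq
      exact lt_iff.2 (Or.inl (by rwa [hfst]))
    · have hp : p.fst ∈ S := (hS _).1 (hfst p ▸ (H p).fst_mem ht)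
      filter_upwards [(key p hp).1] with q hq
      rcases hq ht with hq | hq
      · exact lt_iff.2 (Or.inl (heq ▸ hq))
      · rwa [hq]
  · rcases lt_iff.1 hb with hlt | ⟨heq, ht, ht'⟩
    · rw [hfst] at hlt
      filter_upwards [hcf.continuousAt.eventually (gt_mem_nhds hlt)] with q hq
      exact lt_iff.2 (Or.inl (by rwa [hfst]))
    · have hp : p.fst ∈ S := (hS _).1 (hfst p ▸ heq ▸ b.fst_mem ht')
      filter_upwards [(key p hp).2] with q hq
      rcases hq ht with hq | hq
      · exact lt_iff.2 (Or.inl (heq ▸ hq))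
      · rwa [hq]

/-- A homeomorphism of `A` preserving `S` which is locally monotone at the points of `S` is
covered by a homeomorphism of the split order. -/
theorem exists_homeomorph_covers (h : A ≃ₜ A) (hS : ∀ a, h a ∈ S ↔ a ∈ S)
    (hmono : ∀ s ∈ S, (∀ᶠ z in 𝓝 s, (z < s → h z < h s) ∧ (s < z → h s < h z)) ∨
      ∀ᶠ z in 𝓝 s, (z < s → h s < h z) ∧ (s < z → h z < h s)) :
    ∃ H : SplitOrder S ≃ₜ SplitOrder S, ∀ p, (H p).fst = h p.fst := by
  let F : Set A := {s | s ∈ S ∧ ¬ ∀ᶠ z in 𝓝 s, (z < s → h z < h s) ∧ (s < z → h s < h z)}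
  have hF : F ⊆ S := fun s hs => hs.1
  have hinc : ∀ s ∈ S, s ∉ F → ∀ᶠ z in 𝓝 s, (z < s → h z < h s) ∧ (s < z → h s < h z) :=
    fun s hs hsF => by_contra fun hn => hsF ⟨hs, hn⟩
  have hdec : ∀ s ∈ S, s ∈ F → ∀ᶠ z in 𝓝 s, (z < s → h s < h z) ∧ (s < z → h z < h s) :=
    fun s hs hsF => (hmono s hs).resolve_left hsF.2
  have hSs : ∀ a, h.symm a ∈ S ↔ a ∈ S := fun a => by rw [← hS, h.apply_symm_apply]
  have tend (s : A) : Tendsto h.symm (𝓝 s) (𝓝 (h.symm s)) := h.symm.continuous.continuousAt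
  refine ⟨⟨lift h.toEquiv hS hF, ?_, ?_⟩, fun p => rfl⟩
  · exact continuous_of_covers h.continuous hS hinc hdec (fun p => rfl)
      (fun _ => snd_lift_of_notMem h.toEquiv hS hF) (fun _ => snd_lift_of_mem h.toEquiv hS hF)
  · refine continuous_of_covers h.symm.continuous hSs (F := h.symm ⁻¹' F) ?_ ?_ (fun p => rfl)
      (fun p hp => ?_) (fun p hp => ?_)
    · intro s hs hsF
      filter_upwards [(tend s).eventually (hinc _ ((hSs s).2 hs) hsF)] with z hz
      simp only [h.apply_symm_apply] at hz
      constructor <;> intro hlt <;> rcases lt_trichotomy (h.symm z) (h.symm s) with hc | hc | hc <;>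
        grind [h.symm.injective.eq_iff]
    · intro s hs hsF
      filter_upwards [(tend s).eventually (hdec _ ((hSs s).2 hs) hsF)] with z hz
      simp only [h.apply_symm_apply] at hz
      constructor <;> intro hlt <;> rcases lt_trichotomy (h.symm z) (h.symm s) with hc | hc | hc <;>
        grind [h.symm.injective.eq_iff]
    · exact snd_lift_symm_of_notMem h.toEquiv hS hF hp
    · exact snd_lift_symm_of_mem h.toEquiv hS hF hp

end SplitOrder

/-- The double arrow space as a type carrying only the lexicographic order and its topology,
rather than the structure inherited from the product. -/
def Arrow (X : Set Cantor) : Type := ↥(DoubleArrow X)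

namespace Arrow

variable {X Y : Set Cantor}

/-- The embedding of the double arrow space into the lexicographic product. -/
def toProdLex (p : Arrow X) : Lex (ℕ → Bool) ×ₗ Bool := toLex (toLex p.1.1, p.1.2)

theorem toProdLex_injective : Function.Injective (toProdLex : Arrow X → _) := fun _ _ hpq =>
  Subtype.ext (Prod.ext (congrArg (fun r : Lex (ℕ → Bool) ×ₗ Bool => ofLex (ofLex r).1) hpq)
    (congrArg (fun r : Lex (ℕ → Bool) ×ₗ Bool => (ofLex r).2) hpq))

noncomputable instance : LinearOrder (Arrow X) := LinearOrder.lift' toProdLex toProdLex_injective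

theorem cLt_iff {x y : Cantor} : CLt x y ↔ toLex x < toLex y := by
  change _ ↔ ∃ n, (∀ m, m < n → x m = y m) ∧ x n < y n
  simp only [Bool.lt_iff, CLt]

theorem lt_iff {p q : Arrow X} : p < q ↔ arrowLt X p q := by
  change p.toProdLex < q.toProdLex ↔ _
  rw [Prod.Lex.lt_iff, Bool.lt_iff]
  exact or_congr_left cLt_iff.symm

instance : TopologicalSpace (Arrow X) := arrowTop X

instance : OrderTopology (Arrow X) := ⟨by
  change ordTop (arrowLt X) = TopologicalSpace.generateFrom _
  have hlt : arrowLt X = fun p q : Arrow X => p < q := by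
    ext p q
    exact lt_iff.symm
  rw [ordTop]
  congr 1
  ext s
  rw [hlt]
  exact ⟨fun h => h.elim (fun ⟨a, ha⟩ => ⟨a, Or.inl ha⟩) (fun ⟨a, ha⟩ => ⟨a, Or.inr ha⟩),
    fun ⟨a, ha⟩ => ha.imp (fun h => ⟨a, h⟩) (fun h => ⟨a, h⟩)⟩⟩

theorem mem_of_snd_eq_true (p : Arrow X) (h : p.1.2 = true) : p.1.1 ∈ Q0 ∪ X := by
  rcases p.2 with hp | hp
  · exact absurd (h.symm.trans hp.2) (by simp)
  · exact hp.1

theorem notMem_of_snd_eq_false (p : Arrow X) (h : p.1.2 = false) : p.1.1 ∉ Q0 := by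
  rcases p.2 with hp | hp
  · exact hp.1
  · exact absurd (h.symm.trans hp.2) (by simp)

/-- The points of `𝔸(X)` that are split in `𝔸(Y)`. -/
def splitPoints (X Y : Set Cantor) : Set (Arrow X) := {p | p.1.1 ∈ Y \ X ∧ p.1.2 = false}

/-- The projection from `𝔸(Y)` to `𝔸(X)`. -/
noncomputable def proj (hXY : X ⊆ Y) (p : Arrow Y) : Arrow X := arrowProj X Y hXY p

theorem coe_proj_of_mem (hXY : X ⊆ Y) {p : Arrow Y} (hp : p.1.1 ∈ Q0 ∪ X) :
    (proj hXY p).1 = p.1 := if_pos hp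

theorem coe_proj_of_notMem (hXY : X ⊆ Y) {p : Arrow Y} (hp : p.1.1 ∉ Q0 ∪ X) :
    (proj hXY p).1 = (p.1.1, false) := if_neg hp

theorem coe_proj_fst (hXY : X ⊆ Y) (p : Arrow Y) : (proj hXY p).1.1 = p.1.1 := by
  by_cases hp : p.1.1 ∈ Q0 ∪ X
  · rw [coe_proj_of_mem hXY hp]
  · rw [coe_proj_of_notMem hXY hp]

open Classical in
/-- The canonical map from `𝔸(Y)` to `𝔸(X)` with the points over `Y \ X` split. -/
noncomputable def toSplit (hXY : X ⊆ Y) (p : Arrow Y) : SplitOrder (splitPoints X Y) :=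
  SplitOrder.mk (proj hXY p) (if p.1.1 ∈ Q0 ∪ X then false else p.1.2) fun ht => by
    by_cases hp : p.1.1 ∈ Q0 ∪ X
    · simp [hp] at ht
    · rw [if_neg hp] at ht
      have hp' := p.mem_of_snd_eq_true ht
      rw [mem_union, not_or] at hp
      refine ⟨?_, ?_⟩
      · rw [coe_proj_fst]
        exact ⟨hp'.resolve_left hp.1, hp.2⟩
      · rw [coe_proj_of_notMem hXY (by simpa using hp)]

theorem fst_toSplit (hXY : X ⊆ Y) (p : Arrow Y) : (toSplit hXY p).fst = proj hXY p := rfl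

theorem snd_toSplit_of_mem (hXY : X ⊆ Y) {p : Arrow Y} (hp : p.1.1 ∈ Q0 ∪ X) :
    (toSplit hXY p).snd = false := if_pos hp

theorem snd_toSplit_of_notMem (hXY : X ⊆ Y) {p : Arrow Y} (hp : p.1.1 ∉ Q0 ∪ X) :
    (toSplit hXY p).snd = p.1.2 := if_neg hp

theorem toSplit_strictMono (hXY : X ⊆ Y) : StrictMono (toSplit hXY) := by
  intro p q hpq
  rw [SplitOrder.lt_iff, fst_toSplit, fst_toSplit]
  rcases lt_iff.1 hpq with hlt | ⟨heq, hp, hq⟩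
  · refine Or.inl (lt_iff.2 (Or.inl ?_))
    rwa [coe_proj_fst, coe_proj_fst]
  · by_cases hx : p.1.1 ∈ Q0 ∪ X
    · have hy : q.1.1 ∈ Q0 ∪ X := heq ▸ hx
      refine Or.inl (lt_iff.2 (Or.inr ?_))
      rw [coe_proj_of_mem hXY hx, coe_proj_of_mem hXY hy]
      exact ⟨heq, hp, hq⟩
    · have hy : q.1.1 ∉ Q0 ∪ X := heq ▸ hx
      rw [snd_toSplit_of_notMem hXY hx, snd_toSplit_of_notMem hXY hy]
      refine Or.inr ⟨Subtype.ext ?_, hp, hq⟩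
      rw [coe_proj_of_notMem hXY hx, coe_proj_of_notMem hXY hy, heq]

theorem toSplit_surjective (hXY : X ⊆ Y) : Function.Surjective (toSplit hXY) := by
  intro r
  cases ht : r.snd
  · let p : Arrow Y := ⟨r.fst.1, r.fst.2.imp id fun h => ⟨h.1.imp id fun h => hXY h, h.2⟩⟩
    by_cases hx : p.1.1 ∈ Q0 ∪ X
    · refine ⟨p, SplitOrder.ext (Subtype.ext (coe_proj_of_mem hXY hx)) ?_⟩
      rw [ht, snd_toSplit_of_mem hXY hx]
    · have hp : r.fst.1.2 = false :=
        Bool.eq_false_iff.2 fun h => hx (r.fst.mem_of_snd_eq_true h)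
      refine ⟨p, SplitOrder.ext (Subtype.ext ?_) ?_⟩
      · exact (coe_proj_of_notMem hXY hx).trans (Prod.ext rfl hp.symm)
      · rw [ht, snd_toSplit_of_notMem hXY hx]
        exact hp
  · obtain ⟨hr, hr'⟩ := r.fst_mem ht
    let p : Arrow Y := ⟨(r.fst.1.1, true), Or.inr ⟨Or.inr hr.1, rfl⟩⟩
    have hx : p.1.1 ∉ Q0 ∪ X := fun h => h.elim (r.fst.notMem_of_snd_eq_false hr') hr.2
    refine ⟨p, SplitOrder.ext (Subtype.ext ?_) ?_⟩
    · exact (coe_proj_of_notMem hXY hx).trans (Prod.ext rfl hr'.symm)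
    · rw [ht, snd_toSplit_of_notMem hXY hx]

/-- `𝔸(Y)` is `𝔸(X)` with the points over `Y \ X` split. -/
noncomputable def splitIso (hXY : X ⊆ Y) : Arrow Y ≃o SplitOrder (splitPoints X Y) :=
  (toSplit_strictMono hXY).orderIsoOfSurjective _ (toSplit_surjective hXY)

theorem eventually_of_monotoneAtRel {f : Arrow X → Arrow X} {s : Arrow X}
    (hf : MonotoneAtRel (arrowLt X) f s) :
    (∀ᶠ z in 𝓝 s, (z < s → f z < f s) ∧ (s < z → f s < f z)) ∨
      ∀ᶠ z in 𝓝 s, (z < s → f s < f z) ∧ (s < z → f z < f s) := by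
  obtain ⟨a, b, ha, hb, hf⟩ := hf
  have hab : ∀ᶠ z : Arrow X in 𝓝 s, arrowLt X a z ∧ arrowLt X z b := by
    filter_upwards [Ioo_mem_nhds (lt_iff.2 ha) (lt_iff.2 hb)] with z hz
    exact ⟨lt_iff.1 hz.1, lt_iff.1 hz.2⟩
  simp only [lt_iff]
  exact hf.imp (fun hf => hab.mono fun z hz => ⟨hf.1 z hz.1, fun h => hf.2 z h hz.2⟩)
    (fun hf => hab.mono fun z hz => ⟨hf.1 z hz.1, fun h => hf.2 z h hz.2⟩)

end Arrow

/-- Lifting lemma: a homeomorphism `h` of `𝔸(X)` which is monotone at all points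
`⟨x,0⟩` with `x ∈ Y \ X` and maps `(Y \ X) × {0}` onto itself lifts to a
homeomorphism `H` of `𝔸(Y)` with `π_X^Y ∘ H = h ∘ π_X^Y`. -/
theorem arrow_lifting (X Y : Set Cantor) (hXY : X ⊆ Y) (hYQ : ∀ y ∈ Y, y ∉ QSet)
    (h : @Homeomorph ↥(DoubleArrow X) ↥(DoubleArrow X) (arrowTop X) (arrowTop X))
    (hmono : ∀ p : ↥(DoubleArrow X), (p : Cantor × Bool).1 ∈ Y \ X →
      (p : Cantor × Bool).2 = false → MonotoneAtRel (arrowLt X) (⇑h) p)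
    (himg : h '' {p : ↥(DoubleArrow X) |
        (p : Cantor × Bool).1 ∈ Y \ X ∧ (p : Cantor × Bool).2 = false} =
      {p : ↥(DoubleArrow X) |
        (p : Cantor × Bool).1 ∈ Y \ X ∧ (p : Cantor × Bool).2 = false}) :
    ∃ H : @Homeomorph ↥(DoubleArrow Y) ↥(DoubleArrow Y) (arrowTop Y) (arrowTop Y),
      ∀ p : ↥(DoubleArrow Y),
        arrowProj X Y hXY (H p) = h (arrowProj X Y hXY p) := by
  let k : Arrow X ≃ₜ Arrow X := h
  have himg' : k '' Arrow.splitPoints X Y = Arrow.splitPoints X Y := himg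
  have hS (a : Arrow X) : k a ∈ Arrow.splitPoints X Y ↔ a ∈ Arrow.splitPoints X Y := by
    conv_lhs => rw [← himg']
    exact k.injective.mem_set_image
  obtain ⟨H, hH⟩ := SplitOrder.exists_homeomorph_covers k hS fun s hs =>
    Arrow.eventually_of_monotoneAtRel (hmono s hs.1 hs.2)
  let e : Arrow Y ≃ₜ SplitOrder (Arrow.splitPoints X Y) := (Arrow.splitIso hXY).toHomeomorph
  let G : Arrow Y ≃ₜ Arrow Y := (e.trans H).trans e.symm
  refine ⟨G, fun p => ?_⟩
  have hG : Arrow.splitIso hXY (G p) = H (e p) := e.apply_symm_apply _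
  have hfst : Arrow.proj hXY (G p) = k (Arrow.proj hXY p) :=
    (congrArg SplitOrder.fst hG).trans (hH (e p))
  exact hfst
end
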